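/- arXiv:2209.05988 — 2 statements merged into one kernel-verified Lean document; each statement's English description precedes it below -/
import Mathlib

section
/- Let γ: ℝ/L → ℝ³ be a minimal inspection curve with unfolding γ̃: [0, L] → ℝ². Then γ̃ is locally convex with respect to the origin o: γ̃ is locally one-to-one, and through each point γ̃(t) there passes a local support line of γ̃ such that a neighborhood of γ̃(t) in γ̃ lies on the side of that line containing o. -/
open Real Set MeasureTheory ENNReal

noncomputable section


noncomputable section

abbrev E3 := EuclideanSpace ℝ (Fin 3)

/-- The lift of a curve `γ : ℝ/L → ℝ³` to `ℝ`, via the quotient map `ℝ → ℝ/L`. -/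
def liftCurve (L : ℝ) (γ : AddCircle L → E3) : ℝ → E3 := fun s => γ s

/-- An inspection curve is a closed rectifiable curve `γ : ℝ/L → ℝ³`, parameterized with
constant unit speed (`1`-Lipschitz with total variation `L` over one period), whose convex
hull contains the unit sphere centered at the origin. -/
def IsInspectionCurve (L : ℝ) (γ : AddCircle L → E3) : Prop :=
  0 < L ∧ Continuous γ ∧ LipschitzWith 1 (liftCurve L γ) ∧
    eVariationOn (liftCurve L γ) (Set.Icc 0 L) = ENNReal.ofReal L ∧
    Metric.sphere (0 : E3) 1 ⊆ convexHull ℝ (Set.range γ)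

/-- A minimal inspection curve is an inspection curve of minimal length. -/
def IsMinInspectionCurve (L : ℝ) (γ : AddCircle L → E3) : Prop :=
  IsInspectionCurve L γ ∧
    ∀ (L' : ℝ) (γ' : AddCircle L' → E3), IsInspectionCurve L' γ' → L ≤ L'

/-- The (almost-everywhere defined) derivative of the radial projection
`γ̄ = γ/|γ| : ℝ → S²` of the lifted curve. -/
def projDeriv (L : ℝ) (γ : AddCircle L → E3) : ℝ → E3 :=
  deriv fun s : ℝ => ‖liftCurve L γ s‖⁻¹ • liftCurve L γ s

/-- The arclength function `θ(t) = ∫₀ᵗ |γ̄'(s)| ds` of the radial projection of `γ`. -/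
def thetaFn (L : ℝ) (γ : AddCircle L → E3) (t : ℝ) : ℝ :=
  ∫ u in (0:ℝ)..t, ‖projDeriv L γ u‖

/-- `γt : [0,L] → ℝ² ≅ ℂ` is the unfolding of `γ : ℝ/L → ℝ³`: for the finitely many times
`0 = t₀ < t₁ < ⋯ < t_m = L` at which `γ` passes through the origin (together with the
distinguished endpoints `0` and `L`), one has
`γt(s) = |γ(s)| · e^{i(θ(s) + (k-1)π)}` for `s ∈ [t_{k-1}, t_k]`. -/
def IsUnfolding (L : ℝ) (γ : AddCircle L → E3) (γt : ℝ → ℂ) : Prop :=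
  ∃ (m : ℕ) (tk : ℕ → ℝ), 0 < m ∧ StrictMonoOn tk (Set.Iic m) ∧
    tk 0 = 0 ∧ tk m = L ∧
    (∀ s ∈ Set.Ioo (0:ℝ) L,
      (liftCurve L γ s = 0 ↔ ∃ k : ℕ, 0 < k ∧ k < m ∧ s = tk k)) ∧
    (∀ k : ℕ, 1 ≤ k → k ≤ m → ∀ s ∈ Set.Icc (tk (k-1)) (tk k),
      γt s = (‖liftCurve L γ s‖ : ℂ) *
        Complex.exp (Complex.I * Complex.ofReal (thetaFn L γ s + ((k : ℝ) - 1) * π)))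

/-- The Euclidean dot product on `ℝ² ≅ ℂ`. -/
def dot2 (x y : ℂ) : ℝ := x.re * y.re + x.im * y.im

/-- `σ` has, at the point `σ t`, a local support line lying above `σ` (relative to the
domain `D`): a line through `σ t` (with normal `n ≠ 0`) such that a neighborhood of `t`
in `D` is mapped into the side of the line containing the origin `o`. -/
def HasLocalSupportLineAbove (σ : ℝ → ℂ) (D : Set ℝ) (t : ℝ) : Prop :=
  ∃ n : ℂ, n ≠ 0 ∧ 0 ≤ dot2 n (σ t) ∧
    ∃ U ∈ nhdsWithin t D, ∀ s ∈ U, dot2 n (σ s) ≤ dot2 n (σ t)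

/-- A planar curve `σ` is locally convex with respect to the origin `o` on `D` if it is
locally one-to-one on `D` and through each of its points there passes a local support
line which lies above `σ` (i.e. with the nearby part of `σ` on the side containing `o`). -/
def LocConvexWrtOrigin (σ : ℝ → ℂ) (D : Set ℝ) : Prop :=
  (∀ t ∈ D, ∃ U ∈ nhdsWithin t D, Set.InjOn σ U) ∧
  (∀ t ∈ D, HasLocalSupportLineAbove σ D t)

theorem LipschitzOnWith.norm_deriv_le_Icc {F : Type*} [NormedAddCommGroup F] [NormedSpace ℝ F]
    {g : ℝ → F} {K : NNReal} {a b : ℝ} (hg : LipschitzOnWith K g (Icc a b)) {x : ℝ}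
    (hx : x ∈ Ioo a b) : ‖deriv g x‖ ≤ K :=
  norm_deriv_le_of_lipschitzOn (Icc_mem_nhds hx.1 hx.2) hg

section LipschitzCalculus

variable {F : Type*} [NormedAddCommGroup F] [InnerProductSpace ℝ F] [FiniteDimensional ℝ F]
  {g : ℝ → F} {K : NNReal} {a b : ℝ}

theorem LipschitzOnWith.ae_differentiableAt_Icc (hg : LipschitzOnWith K g (Icc a b)) :
    ∀ᵐ x, x ∈ Ioo a b → DifferentiableAt ℝ g x := by
  filter_upwards [hg.ae_differentiableWithinAt_of_mem_real] with x hx hxab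
  exact (hx (Ioo_subset_Icc_self hxab)).differentiableAt (Icc_mem_nhds hxab.1 hxab.2)

theorem ae_ne_right (b : ℝ) : ∀ᵐ x : ℝ, x ≠ b := by simp [ae_iff, measure_singleton]

theorem ae_Ioc_of_ae_Ioo {p : ℝ → Prop} (h : ∀ᵐ x, x ∈ Ioo a b → p x) :
    ∀ᵐ x, x ∈ Ioc a b → p x := by
  filter_upwards [h, ae_ne_right b] with x hx hne hxab
  exact hx ⟨hxab.1, lt_of_le_of_ne hxab.2 hne⟩

theorem LipschitzOnWith.intervalIntegrable_norm_deriv (hg : LipschitzOnWith K g (Icc a b))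
    (hab : a ≤ b) : IntervalIntegrable (fun x => ‖deriv g x‖) volume a b := by
  rw [intervalIntegrable_iff_integrableOn_Ioc_of_le hab]
  borelize F
  refine Measure.integrableOn_of_bounded (M := K) (by simp)
    (measurable_deriv g).norm.aestronglyMeasurable ?_
  rw [ae_restrict_iff' measurableSet_Ioc]
  refine ae_Ioc_of_ae_Ioo (Filter.Eventually.of_forall fun x hx => ?_)
  simpa using hg.norm_deriv_le_Icc hx

theorem LipschitzOnWith.norm_sub_le_integral (hg : LipschitzOnWith K g (Icc a b)) (hab : a ≤ b) :
    ‖g b - g a‖ ≤ ∫ x in a..b, ‖deriv g x‖ := by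
  set w := g b - g a with hw
  have hint := hg.intervalIntegrable_norm_deriv hab
  have hφ : AbsolutelyContinuousOnInterval (fun x => inner ℝ w (g x)) a b := by
    have h2 : LipschitzOnWith (‖innerSL ℝ w‖₊ * K) (fun x => inner ℝ w (g x)) (uIcc a b) := by
      rw [uIcc_of_le hab]
      exact (innerSL ℝ w).lipschitz.comp_lipschitzOnWith hg
    exact h2.absolutelyContinuousOnInterval
  have h1 := hφ.integral_deriv_eq_sub
  have h3 : inner ℝ w (g b) - inner ℝ w (g a) = ‖w‖ * ‖w‖ := by
    rw [← inner_sub_right, ← hw, real_inner_self_eq_norm_mul_norm]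
  rw [h3] at h1
  have h4 : ∫ x in a..b, deriv (fun x => inner ℝ w (g x)) x ≤ ∫ x in a..b, ‖w‖ * ‖deriv g x‖ := by
    refine intervalIntegral.integral_mono_ae_restrict hab hφ.intervalIntegrable_deriv
      (hint.const_mul _) ?_
    rw [Filter.EventuallyLE, ae_restrict_iff' measurableSet_Icc]
    filter_upwards [hg.ae_differentiableAt_Icc, ae_ne_right a, ae_ne_right b] with x hx hxa hxb hxab
    have hd := (hx ⟨lt_of_le_of_ne hxab.1 hxa.symm, lt_of_le_of_ne hxab.2 hxb⟩).hasDerivAt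
    have := ((innerSL ℝ w).hasFDerivAt.comp_hasDerivAt x hd).deriv
    simp only [Function.comp_def, innerSL_apply_apply] at this
    rw [this]
    exact real_inner_le_norm _ _
  rw [intervalIntegral.integral_const_mul, h1] at h4
  rcases eq_or_lt_of_le (norm_nonneg w) with h | h
  · rw [← h]
    exact intervalIntegral.integral_nonneg hab fun x _ => norm_nonneg _
  · exact le_of_mul_le_mul_left h4 h

theorem integral_le_of_ae_le {φ ψ : ℝ → ℝ} (hab : a ≤ b) (hφ : IntervalIntegrable φ volume a b)
    (hψ : IntervalIntegrable ψ volume a b) (h : ∀ᵐ x, x ∈ Ioo a b → φ x ≤ ψ x) :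
    ∫ x in a..b, φ x ≤ ∫ x in a..b, ψ x := by
  refine intervalIntegral.integral_mono_ae_restrict hab hφ hψ ?_
  rw [Filter.EventuallyLE, ae_restrict_iff' measurableSet_Icc]
  filter_upwards [h, ae_ne_right a, ae_ne_right b] with x hx hxa hxb hxab
  exact hx ⟨lt_of_le_of_ne hxab.1 hxa.symm, lt_of_le_of_ne hxab.2 hxb⟩

theorem LipschitzOnWith.norm_sub_le_of_ae (hg : LipschitzOnWith K g (Icc a b)) (hab : a ≤ b)
    {C : ℝ} (hC : ∀ᵐ x, x ∈ Ioo a b → ‖deriv g x‖ ≤ C) : ‖g b - g a‖ ≤ C * (b - a) := by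
  refine (hg.norm_sub_le_integral hab).trans ?_
  refine (integral_le_of_ae_le hab (hg.intervalIntegrable_norm_deriv hab)
    (intervalIntegrable_const (c := C)) hC).trans ?_
  simp [mul_comm]

theorem LipschitzOnWith.eVariationOn_le_integral (hg : LipschitzOnWith K g (Icc a b))
    (hab : a ≤ b) :
    eVariationOn g (Icc a b) ≤ ENNReal.ofReal (∫ x in a..b, ‖deriv g x‖) := by
  set I : ℝ → ℝ := fun y => ∫ x in a..y, ‖deriv g x‖ with hI
  have hint := hg.intervalIntegrable_norm_deriv hab
  have hsub : ∀ x ∈ Icc a b, ∀ y ∈ Icc a b, x ≤ y → ‖g y - g x‖ ≤ I y - I x := by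
    intro x hx y hy hxy
    have h1 : IntervalIntegrable (fun x => ‖deriv g x‖) volume a x :=
      hint.mono_set (by rw [uIcc_of_le hab, uIcc_of_le hx.1]; exact Icc_subset_Icc_right hx.2)
    have h2 : IntervalIntegrable (fun x => ‖deriv g x‖) volume a y :=
      hint.mono_set (by rw [uIcc_of_le hab, uIcc_of_le hy.1]; exact Icc_subset_Icc_right hy.2)
    rw [hI]
    simp only
    rw [intervalIntegral.integral_interval_sub_left h2 h1]
    exact (hg.mono (Icc_subset_Icc hx.1 hy.2)).norm_sub_le_integral hxy
  have hmono : MonotoneOn I (Icc a b) := fun x hx y hy hxy => by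
    have := (norm_nonneg _).trans (hsub x hx y hy hxy)
    linarith
  have hle : eVariationOn g (Icc a b) ≤ eVariationOn I (Icc a b) := by
    refine iSup_le fun p => ?_
    refine le_trans (Finset.sum_le_sum fun i _ => ?_) (eVariationOn.sum_le (f := I) p.2.2.1 p.2.2.2)
    rw [edist_dist, edist_dist]
    apply ENNReal.ofReal_le_ofReal
    have hi := hsub _ (p.2.2.2 i) _ (p.2.2.2 (i + 1)) (p.2.2.1 (Nat.le_succ i))
    rw [dist_eq_norm, dist_eq_norm]
    exact hi.trans (le_abs_self _)
  refine hle.trans ?_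
  have := hmono.eVariationOn_eq (left_mem_Icc.2 hab) (right_mem_Icc.2 hab)
  rw [inter_self] at this
  refine this.le.trans (le_of_eq ?_)
  simp [hI]

end LipschitzCalculus

theorem LipschitzOnWith.periodize {E : Type*} [PseudoMetricSpace E] {g : ℝ → E} {V : ℝ}
    (hV : 0 < V) (hg : LipschitzOnWith 1 g (Icc 0 V)) (h0 : g 0 = g V) :
    LipschitzWith 1 fun s => g (toIcoMod hV 0 s) := by
  have hm : ∀ s, toIcoMod hV 0 s ∈ Ico 0 V := fun s => toIcoMod_mem_Ico' hV s
  have key : ∀ x y, x ≤ y → dist (g (toIcoMod hV 0 x)) (g (toIcoMod hV 0 y)) ≤ y - x := by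
    intro x y hxy
    have hx := toIcoMod_add_toIcoDiv_mul hV 0 x
    have hy := toIcoMod_add_toIcoDiv_mul hV 0 y
    obtain ⟨hx0, hx1⟩ := hm x
    obtain ⟨hy0, hy1⟩ := hm y
    set x' := toIcoMod hV 0 x
    set y' := toIcoMod hV 0 y
    set i := toIcoDiv hV 0 x
    set j := toIcoDiv hV 0 y
    have hL : ∀ u ∈ Icc 0 V, ∀ v ∈ Icc 0 V, dist (g u) (g v) ≤ |u - v| := by
      intro u hu v hv
      simpa [Real.dist_eq] using hg.dist_le_mul u hu v hv
    rcases lt_trichotomy i j with h | h | h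
    · have h1 := hL x' ⟨hx0, hx1.le⟩ V ⟨hV.le, le_rfl⟩
      have h2 := hL 0 ⟨le_rfl, hV.le⟩ y' ⟨hy0, hy1.le⟩
      rw [abs_of_nonpos (by linarith)] at h1 h2
      rw [h0] at h2
      have h3 := dist_triangle (g x') (g V) (g y')
      have h4 : (i : ℝ) + 1 ≤ j := by exact_mod_cast h
      nlinarith
    · have h1 := hL x' ⟨hx0, hx1.le⟩ y' ⟨hy0, hy1.le⟩
      rw [h] at hx
      rw [abs_of_nonpos (by linarith)] at h1
      linarith
    · exfalso
      have h4 : (j : ℝ) + 1 ≤ i := by exact_mod_cast h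
      nlinarith
  refine LipschitzWith.of_dist_le_mul fun x y => ?_
  simp only [NNReal.coe_one, one_mul]
  rcases le_total x y with h | h
  · refine (key x y h).trans ?_
    rw [dist_comm]
    exact le_abs_self _
  · rw [dist_comm]
    exact (key y x h).trans (le_abs_self _)

/-- A set whose support function exceeds `R > 1` in every direction has the unit ball in its
convex hull. -/
theorem sphere_subset_convexHull {F : Type*} [NormedAddCommGroup F] [InnerProductSpace ℝ F]
    [FiniteDimensional ℝ F] [Nontrivial F] {S : Set F} {R : ℝ} (hR : 1 < R)
    (h : ∀ n : F, ‖n‖ = 1 → ∃ x ∈ S, R ≤ inner ℝ n x) :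
    Metric.sphere (0 : F) 1 ⊆ convexHull ℝ S := by
  have hball : Metric.ball (0 : F) R ⊆ closure (convexHull ℝ S) := by
    intro x hx
    by_contra hxS
    obtain ⟨f, u, hf, hu⟩ := geometric_hahn_banach_closed_point
      (convex_convexHull ℝ S).closure isClosed_closure hxS
    set w := (InnerProductSpace.toDual ℝ F).symm f with hw
    have hfw : ∀ y, f y = inner ℝ w y := fun y => by
      rw [hw, InnerProductSpace.toDual_symm_apply]
    have hS : ∀ y ∈ S, inner ℝ w y < u := fun y hy => by
      rw [← hfw]; exact hf y (subset_closure (subset_convexHull ℝ S hy))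
    rw [hfw] at hu
    have hxR : ‖x‖ < R := by simpa using hx
    by_cases hw0 : w = 0
    · obtain ⟨e, he⟩ : ∃ e : F, ‖e‖ = 1 := exists_norm_eq F zero_le_one
      obtain ⟨y, hy, -⟩ := h e he
      have := hS y hy
      simp [hw0] at this hu
      linarith
    · have hwp : 0 < ‖w‖ := norm_pos_iff.2 hw0
      obtain ⟨y, hy, hyR⟩ := h (‖w‖⁻¹ • w) (by rw [norm_smul, norm_inv, norm_norm, inv_mul_cancel₀ hwp.ne'])
      rw [real_inner_smul_left, le_inv_mul_iff₀ hwp] at hyR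
      have := hS y hy
      have h2 := real_inner_le_norm w x
      nlinarith
  have hne : (interior (convexHull ℝ S)).Nonempty := by
    rw [interior_convexHull_nonempty_iff_affineSpan_eq_top]
    have h1 : (interior (affineSpan ℝ S : Set F)).Nonempty := by
      refine ⟨0, mem_interior.2 ⟨Metric.ball 0 R, ?_, Metric.isOpen_ball, by simp; linarith⟩⟩
      refine hball.trans (closure_minimal (convexHull_subset_affineSpan S) ?_)
      exact AffineSubspace.closed_of_finiteDimensional _
    have := affineSpan_eq_top_of_nonempty_interior (s := (affineSpan ℝ S : Set F)) (h1.mono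
      (interior_mono (subset_convexHull ℝ _)))
    simpa using this
  have h2 := (convex_convexHull ℝ S).interior_closure_eq_interior_of_nonempty_interior hne
  refine Subset.trans ?_ (interior_subset (s := convexHull ℝ S))
  rw [← h2]
  refine Subset.trans ?_ (interior_maximal hball Metric.isOpen_ball)
  intro x hx
  have : ‖x‖ = 1 := by simpa using hx
  simp [this, hR]

theorem exists_one_le_inner {S : Set E3} (h : Metric.sphere (0 : E3) 1 ⊆ convexHull ℝ S)
    {n : E3} (hn : ‖n‖ = 1) : ∃ x ∈ S, 1 ≤ inner ℝ n x := by
  have h1 : n ∈ convexHull ℝ S := h (by simp [hn])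
  by_contra! hlt
  have h2 : convexHull ℝ S ⊆ {x | inner ℝ n x < 1} :=
    convexHull_min (fun x hx => hlt x hx) (convex_halfSpace_lt (innerSL ℝ n).isLinear 1)
  have := h2 h1
  simp [hn] at this

theorem IsMinInspectionCurve.le_eVariationOn {L : ℝ} {γ : AddCircle L → E3}
    (hγ : IsMinInspectionCurve L γ) {f : ℝ → E3} {K : NNReal} {a b R : ℝ} (hab : a ≤ b)
    (hf : LipschitzOnWith K f (Icc a b)) (hcl : f a = f b) (hR : 1 < R)
    (hI : ∀ n : E3, ‖n‖ = 1 → ∃ s ∈ Icc a b, R ≤ inner ℝ n (f s)) :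
    L ≤ (eVariationOn f (Icc a b)).toReal := by
  have hbv : LocallyBoundedVariationOn f (Icc a b) := hf.locallyBoundedVariationOn
  have ha : a ∈ Icc a b := ⟨le_rfl, hab⟩
  have hb : b ∈ Icc a b := ⟨hab, le_rfl⟩
  set φ := variationOnFromTo f (Icc a b) a with hφ
  set g := naturalParameterization f (Icc a b) a with hg
  have hgφ : ∀ s ∈ Icc a b, g (φ s) = f s := fun s hs =>
    edist_eq_zero.1 (edist_naturalParameterization_eq_zero hbv ha hs)
  set V := (eVariationOn f (Icc a b)).toReal with hV
  have hφa : φ a = 0 := variationOnFromTo.self _ _ _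
  have hφb : φ b = V := by
    rw [hφ, variationOnFromTo.eq_of_le _ _ hab, inter_self]
  have hmono : MonotoneOn φ (Icc a b) := variationOnFromTo.monotoneOn hbv ha
  have hφL : LipschitzOnWith K φ (Icc a b) := by
    refine LipschitzOnWith.of_le_add_mul K fun x hx y hy => ?_
    rcases le_total x y with h | h
    · have := hmono hx hy h
      have h2 : 0 ≤ (K : ℝ) * dist x y := by positivity
      linarith
    · have h1 : φ x - φ y = variationOnFromTo f (Icc a b) y x :=
        variationOnFromTo.sub_right hbv ha hx hy
      rw [variationOnFromTo.eq_of_le _ _ h] at h1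
      have h3 : Icc a b ∩ Icc y x = Icc y x := inter_eq_right.2 (Icc_subset_Icc hy.1 hx.2)
      rw [h3] at h1
      have h4 : eVariationOn f (Icc y x) ≤ ENNReal.ofReal (K * (x - y)) := by
        have := (hf.mono (Icc_subset_Icc hy.1 hx.2)).comp_eVariationOn_le (f := f)
          (g := fun t : ℝ => t) (s := Icc y x) (fun t ht => ht)
        refine this.trans ?_
        have h5 : eVariationOn (fun t : ℝ => t) (Icc y x) ≤ ENNReal.ofReal (x - y) := by
          have h6 := MonotoneOn.eVariationOn_eq (f := fun t : ℝ => t) (s := Icc y x)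
            (fun u _ v _ h => h) (a := y) (b := x) ⟨le_rfl, h⟩ ⟨h, le_rfl⟩
          rw [inter_self] at h6
          exact h6.le
        rw [ENNReal.ofReal_mul K.coe_nonneg]
        rw [ENNReal.ofReal_coe_nnreal]
        gcongr
      have h5 := ENNReal.toReal_mono ENNReal.ofReal_ne_top h4
      rw [ENNReal.toReal_ofReal (mul_nonneg K.coe_nonneg (by linarith))] at h5
      rw [Real.dist_eq, abs_of_nonneg (by linarith)]
      linarith
  have himg : φ '' Icc a b = Icc 0 V := by
    apply Subset.antisymm
    · rintro _ ⟨s, hs, rfl⟩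
      exact ⟨hφa ▸ hmono ha hs hs.1, hφb ▸ hmono hs hb hs.2⟩
    · have := intermediate_value_Icc hab hφL.continuousOn
      rwa [hφa, hφb] at this
  have hunit : HasUnitSpeedOn g (Icc 0 V) := by
    have := has_unit_speed_naturalParameterization f hbv ha
    rwa [himg] at this
  have hV0 : 0 ≤ V := ENNReal.toReal_nonneg
  have hgvar : eVariationOn g (Icc 0 V) = ENNReal.ofReal V := by
    have := hunit (x := 0) ⟨le_rfl, hV0⟩ (y := V) ⟨hV0, le_rfl⟩
    simpa using this
  have hgL : LipschitzOnWith 1 g (Icc 0 V) := by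
    have key : ∀ x ∈ Icc 0 V, ∀ y ∈ Icc 0 V, x ≤ y → edist (g x) (g y) ≤ edist x y := by
      intro x hx y hy h
      have h1 := hunit hx hy
      rw [edist_comm x, edist_dist y, Real.dist_eq, abs_of_nonneg (by linarith)]
      simp only [NNReal.coe_one, one_mul] at h1
      rw [← h1]
      exact eVariationOn.edist_le g ⟨hx, le_rfl, h⟩ ⟨hy, h, le_rfl⟩
    intro x hx y hy
    simp only [ENNReal.coe_one, one_mul]
    rcases le_total x y with h | h
    · exact key x hx y hy h
    · rw [edist_comm, edist_comm x]
      exact key y hy x hx h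
  have hg0 : g 0 = g V := by rw [← hφa, ← hφb, hgφ a ha, hgφ b hb, hcl]
  have hVpos : 0 < V := by
    refine lt_of_le_of_ne hV0 fun hV' => ?_
    have hconst : ∀ s ∈ Icc a b, f s = g 0 := fun s hs => by
      have : φ s ∈ Icc 0 V := himg ▸ mem_image_of_mem φ hs
      rw [← hV', Icc_self] at this
      rw [← hgφ s hs, this]
    obtain ⟨n, hn⟩ : ∃ e : E3, ‖e‖ = 1 := exists_norm_eq E3 zero_le_one
    obtain ⟨s, hs, h1⟩ := hI n hn
    obtain ⟨s', hs', h2⟩ := hI (-n) (by simpa)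
    rw [hconst s hs] at h1
    rw [hconst s' hs', inner_neg_left] at h2
    linarith
  have : Fact (0 < V) := ⟨hVpos⟩
  refine hγ.2 V (AddCircle.liftIco V 0 g) ?_
  have hlift : liftCurve V (AddCircle.liftIco V 0 g) = fun s => g (toIcoMod hVpos 0 s) := by
    funext s
    rfl
  have hlip : LipschitzWith 1 (liftCurve V (AddCircle.liftIco V 0 g)) := by
    rw [hlift]
    exact hgL.periodize hVpos hg0
  have heq : EqOn (liftCurve V (AddCircle.liftIco V 0 g)) g (Icc 0 V) := by
    intro s hs
    rw [hlift]
    rcases eq_or_lt_of_le hs.2 with h | h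
    · subst h
      have := toIcoMod_apply_right hVpos 0
      rw [zero_add] at this
      simp only [this, hg0]
    · show g (toIcoMod hVpos 0 s) = g s
      rw [(toIcoMod_eq_self hVpos).2 ⟨hs.1, by simpa using h⟩]
  refine ⟨hVpos, ?_, hlip, ?_, ?_⟩
  · exact AddCircle.liftIco_zero_continuous hg0 hgL.continuousOn
  · rw [eVariationOn.eq_of_eqOn heq, hgvar]
  · refine sphere_subset_convexHull hR fun n hn => ?_
    obtain ⟨s, hs, h⟩ := hI n hn
    refine ⟨f s, ⟨(φ s : ℝ), ?_⟩, h⟩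
    have hφs : φ s ∈ Icc 0 V := himg ▸ mem_image_of_mem φ hs
    rw [← hgφ s hs, ← heq hφs, liftCurve]

/-- Closed Lipschitz curves with unit support in every direction are at least as long as a
minimal inspection curve. -/
theorem IsMinInspectionCurve.le_integral {L : ℝ} {γ : AddCircle L → E3}
    (hγ : IsMinInspectionCurve L γ) {f : ℝ → E3} {K : NNReal} {a b : ℝ} (hab : a ≤ b)
    (hf : LipschitzOnWith K f (Icc a b)) (hcl : f a = f b)
    (hI : ∀ n : E3, ‖n‖ = 1 → ∃ s ∈ Icc a b, 1 ≤ inner ℝ n (f s)) :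
    L ≤ ∫ x in a..b, ‖deriv f x‖ := by
  have key : ∀ R : ℝ, 1 < R → L ≤ R * ∫ x in a..b, ‖deriv f x‖ := by
    intro R hR
    have hfR : LipschitzOnWith (‖R‖₊ * K) (fun s => R • f s) (Icc a b) :=
      (lipschitzWith_smul R).comp_lipschitzOnWith hf
    have h1 := hγ.le_eVariationOn hab hfR (by simp [hcl]) hR (fun n hn => by
      obtain ⟨s, hs, h⟩ := hI n hn
      refine ⟨s, hs, ?_⟩
      rw [real_inner_smul_right]
      nlinarith)
    refine h1.trans ?_
    have h0 : 0 ≤ ∫ x in a..b, ‖deriv (fun s => R • f s) x‖ :=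
      intervalIntegral.integral_nonneg hab fun _ _ => norm_nonneg _
    have h2 := ENNReal.toReal_mono ENNReal.ofReal_ne_top (hfR.eVariationOn_le_integral hab)
    rw [ENNReal.toReal_ofReal h0] at h2
    refine h2.trans (le_of_eq ?_)
    rw [← intervalIntegral.integral_const_mul]
    refine intervalIntegral.integral_congr fun x _ => ?_
    show ‖deriv (fun s => R • f s) x‖ = R * ‖deriv f x‖
    rw [deriv_fun_const_smul_field, norm_smul, Real.norm_of_nonneg (by linarith)]
  refine ge_of_tendsto (x := nhdsWithin 1 (Ioi 1))
    (f := fun R : ℝ => R * ∫ x in a..b, ‖deriv f x‖) ?_ ?_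
  · have : ContinuousAt (fun R : ℝ => R * ∫ x in a..b, ‖deriv f x‖) 1 := by fun_prop
    simpa using this.tendsto.mono_left nhdsWithin_le_nhds
  · filter_upwards [self_mem_nhdsWithin] with R hR using key R hR

theorem LipschitzOnWith.glue_Icc {E : Type*} [PseudoMetricSpace E] {g : ℝ → E} {K : NNReal}
    {a b d : ℝ} (h₁ : LipschitzOnWith K g (Icc a b)) (h₂ : LipschitzOnWith K g (Icc b d)) :
    LipschitzOnWith K g (Icc a d) := by
  have key : ∀ x ∈ Icc a d, ∀ y ∈ Icc a d, x ≤ y → dist (g x) (g y) ≤ K * dist x y := by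
    intro x hx y hy hxy
    rcases le_total y b with hyb | hyb
    · exact h₁.dist_le_mul x ⟨hx.1, hxy.trans hyb⟩ y ⟨hy.1, hyb⟩
    rcases le_total x b with hxb | hxb
    · have e1 := h₁.dist_le_mul x ⟨hx.1, hxb⟩ b ⟨hx.1.trans hxb, le_rfl⟩
      have e2 := h₂.dist_le_mul b ⟨le_rfl, hyb.trans hy.2⟩ y ⟨hyb, hy.2⟩
      have e3 := dist_triangle (g x) (g b) (g y)
      have e4 : dist x y = dist x b + dist b y := by
        simp only [Real.dist_eq]
        rw [abs_of_nonpos (by linarith), abs_of_nonpos (by linarith), abs_of_nonpos (by linarith)]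
        ring
      rw [e4, mul_add]
      linarith
    · exact h₂.dist_le_mul x ⟨hxb, hx.2⟩ y ⟨hyb, hy.2⟩
  refine LipschitzOnWith.of_dist_le_mul fun x hx y hy => ?_
  rcases le_total x y with h | h
  · exact key x hx y hy h
  · rw [dist_comm, dist_comm x]
    exact key y hy x hx h

/-- A closed unit-speed curve of period `L` with unit support in every direction, of minimal
length among all closed Lipschitz curves with this property. -/
structure IsMinLoop (L : ℝ) (c : ℝ → E3) : Prop where
  pos : 0 < L
  periodic : Function.Periodic c L
  lip : LipschitzWith 1 c
  supp : ∀ n : E3, ‖n‖ = 1 → ∃ s, 1 ≤ inner ℝ n (c s)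
  le_integral : ∀ (f : ℝ → E3) (K : NNReal) (a b : ℝ), a ≤ b → LipschitzOnWith K f (Icc a b) →
    f a = f b → (∀ n : E3, ‖n‖ = 1 → ∃ s ∈ Icc a b, 1 ≤ inner ℝ n (f s)) →
    L ≤ ∫ x in a..b, ‖deriv f x‖

theorem IsMinInspectionCurve.isMinLoop {L : ℝ} {γ : AddCircle L → E3}
    (hγ : IsMinInspectionCurve L γ) : IsMinLoop L (liftCurve L γ) where
  pos := hγ.1.1
  periodic := fun s => by simp [liftCurve]
  lip := hγ.1.2.2.1
  supp := fun n hn => by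
    obtain ⟨_, ⟨x, rfl⟩, h⟩ := exists_one_le_inner hγ.1.2.2.2.2 hn
    obtain ⟨s, rfl⟩ := QuotientAddGroup.mk_surjective x
    exact ⟨s, h⟩
  le_integral := fun _ _ _ _ hab hf hcl hI => hγ.le_integral hab hf hcl hI

namespace IsMinLoop

variable {L : ℝ} {c : ℝ → E3}

theorem norm_sub_le (hc : IsMinLoop L c) (x y : ℝ) : ‖c x - c y‖ ≤ |x - y| := by
  simpa [dist_eq_norm] using hc.lip.dist_le_mul x y

theorem norm_deriv_le (hc : IsMinLoop L c) (x : ℝ) : ‖deriv c x‖ ≤ 1 := by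
  simpa using norm_deriv_le_of_lipschitz (x₀ := x) hc.lip

theorem mul_le_integral (hc : IsMinLoop L c) {κ : ℝ} (hκ : 0 < κ) {f : ℝ → E3} {K : NNReal} {a b : ℝ} (hab : a ≤ b)
    (hf : LipschitzOnWith K f (Icc a b)) (hcl : f a = f b)
    (hI : ∀ n : E3, ‖n‖ = 1 → ∃ s ∈ Icc a b, κ ≤ inner ℝ n (f s)) :
    κ * L ≤ ∫ x in a..b, ‖deriv f x‖ := by
  have h := hc.le_integral (fun s => κ⁻¹ • f s) (‖κ⁻¹‖₊ * K) a b hab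
    ((lipschitzWith_smul κ⁻¹).comp_lipschitzOnWith hf) (by simp [hcl]) (fun n hn => by
      obtain ⟨s, hs, h⟩ := hI n hn
      refine ⟨s, hs, ?_⟩
      rw [real_inner_smul_right, le_inv_mul_iff₀ hκ]
      simpa using h)
  rw [show (∫ x in a..b, ‖deriv (fun s => κ⁻¹ • f s) x‖) = κ⁻¹ * ∫ x in a..b, ‖deriv f x‖ by
    rw [← intervalIntegral.integral_const_mul]
    refine intervalIntegral.integral_congr fun x _ => ?_
    simp only [deriv_fun_const_smul_field, norm_smul, norm_inv, Real.norm_of_nonneg hκ.le]] at h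
  rwa [le_inv_mul_iff₀ hκ] at h

/-- Replacing an arc of a minimal loop does not shorten it, up to the loss of support. -/
theorem competitor (hc : IsMinLoop L c) {κ : ℝ} (hκ : 0 < κ) {δ : ℝ → E3} {K : NNReal} {a b : ℝ} (hab : a ≤ b)
    (hbL : b ≤ a + L) (hδ : LipschitzOnWith K δ (Icc a b)) (ha : δ a = c a) (hb : δ b = c b)
    (hI : ∀ n : E3, ‖n‖ = 1 → (∃ s ∈ Icc b (a + L), κ ≤ inner ℝ n (c s)) ∨
      ∃ s ∈ Icc a b, κ ≤ inner ℝ n (δ s)) :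
    κ * L ≤ (L - (b - a)) + ∫ x in a..b, ‖deriv δ x‖ := by
  set f : ℝ → E3 := fun s => if s ≤ b then δ s else c s with hf
  have f1 : EqOn f δ (Icc a b) := fun s hs => if_pos hs.2
  have f2 : EqOn f c (Icc b (a + L)) := fun s hs => by
    rcases eq_or_lt_of_le hs.1 with h | h
    · rw [← h, hf]; simp [hb]
    · exact if_neg (not_le.2 h)
  have hf1 : LipschitzOnWith (max K 1) f (Icc a b) := by
    intro x hx y hy
    rw [f1 hx, f1 hy]
    exact hδ.weaken (le_max_left _ _) hx hy
  have hf2 : LipschitzOnWith (max K 1) f (Icc b (a + L)) := by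
    intro x hx y hy
    rw [f2 hx, f2 hy]
    exact hc.lip.weaken (le_max_right _ _) x y
  have hlip := hf1.glue_Icc hf2
  have hcl : f a = f (a + L) := by
    rw [f1 ⟨le_rfl, hab⟩, f2 ⟨hbL, le_rfl⟩, hc.periodic, ha]
  have haL : a ≤ a + L := hab.trans hbL
  have h := hc.mul_le_integral hκ haL hlip hcl (fun n hn => by
    rcases hI n hn with ⟨s, hs, h⟩ | ⟨s, hs, h⟩
    · exact ⟨s, ⟨hab.trans hs.1, hs.2⟩, by rwa [f2 hs]⟩
    · exact ⟨s, ⟨hs.1, hs.2.trans hbL⟩, by rwa [f1 hs]⟩)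
  rw [← intervalIntegral.integral_add_adjacent_intervals (b := b)
    (hf1.intervalIntegrable_norm_deriv hab) (hf2.intervalIntegrable_norm_deriv hbL)] at h
  have e1 : ∫ x in a..b, ‖deriv f x‖ ≤ ∫ x in a..b, ‖deriv δ x‖ := by
    refine integral_le_of_ae_le hab (hf1.intervalIntegrable_norm_deriv hab)
      (hδ.intervalIntegrable_norm_deriv hab) (Filter.Eventually.of_forall fun x hx => ?_)
    rw [Filter.EventuallyEq.deriv_eq (Filter.eventuallyEq_of_mem (Icc_mem_nhds hx.1 hx.2) f1)]
  have e2 : ∫ x in b..(a + L), ‖deriv f x‖ ≤ ∫ x in b..(a + L), (1 : ℝ) := by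
    refine integral_le_of_ae_le hbL (hf2.intervalIntegrable_norm_deriv hbL)
      (by simp) (Filter.Eventually.of_forall fun x hx => ?_)
    rw [Filter.EventuallyEq.deriv_eq (Filter.eventuallyEq_of_mem (Icc_mem_nhds hx.1 hx.2) f2)]
    exact hc.norm_deriv_le x
  simp only [intervalIntegral.integral_const, smul_eq_mul, mul_one] at e2
  linarith

theorem exists_mem_Icc_eq (hc : IsMinLoop L c) (a s : ℝ) : ∃ s' ∈ Ico a (a + L), c s' = c s := by
  obtain ⟨y, hy, h⟩ := hc.periodic.exists_mem_Ico hc.pos s a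
  exact ⟨y, hy, h.symm⟩

theorem supp_cases (hc : IsMinLoop L c) (a b : ℝ) (n : E3) (hn : ‖n‖ = 1) :
    (∃ s ∈ Icc b (a + L), 1 ≤ inner ℝ n (c s)) ∨ ∃ s ∈ Icc a b, 1 ≤ inner ℝ n (c s) := by
  obtain ⟨s, hs⟩ := hc.supp n hn
  obtain ⟨s', hs', h⟩ := hc.exists_mem_Icc_eq a s
  rw [← h] at hs
  rcases le_total s' b with hb | hb
  · exact Or.inr ⟨s', ⟨hs'.1, hb⟩, hs⟩
  · exact Or.inl ⟨s', ⟨hb, hs'.2.le⟩, hs⟩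

/-- Integral form of unit speed. -/
theorem le_integral_norm_deriv (hc : IsMinLoop L c) {a b : ℝ} (hab : a ≤ b) (hbL : b ≤ a + L) :
    b - a ≤ ∫ x in a..b, ‖deriv c x‖ := by
  have := hc.competitor one_pos hab hbL hc.lip.lipschitzOnWith rfl rfl (hc.supp_cases a b)
  linarith

/-- An arc that is not needed for the support condition is a straight segment. -/
theorem chord (hc : IsMinLoop L c) {a b : ℝ} (hab : a < b) (hbL : b ≤ a + L)
    (hI : ∀ n : E3, ‖n‖ = 1 → (∃ s ∈ Icc a b, 1 ≤ inner ℝ n (c s)) →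
      ∃ s ∈ Icc b (a + L), 1 ≤ inner ℝ n (c s)) :
    ‖c b - c a‖ = b - a := by
  refine le_antisymm ((hc.norm_sub_le b a).trans (by rw [abs_of_nonneg (by linarith)])) ?_
  set v : E3 := (b - a)⁻¹ • (c b - c a) with hv
  have hba : 0 < b - a := sub_pos.2 hab
  set δ : ℝ → E3 := fun s => c a + (s - a) • v with hδ
  have hd : ∀ x, HasDerivAt δ v x := fun x => by
    have := (((hasDerivAt_id x).sub_const a).smul_const v).const_add (c a)
    rwa [one_smul] at this
  have hlip : LipschitzOnWith ‖v‖₊ δ (Icc a b) := by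
    refine (lipschitzWith_of_nnnorm_deriv_le (fun x => (hd x).differentiableAt)
      fun x => ?_).lipschitzOnWith
    rw [(hd x).deriv]
  have := hc.competitor one_pos hab.le hbL hlip (by simp [hδ])
    (by simp [hδ, hv, smul_smul, mul_inv_cancel₀ hba.ne']) (fun n hn => by
      rcases hc.supp_cases a b n hn with h | h
      · exact Or.inl h
      · exact Or.inl (hI n hn h))
  simp only [(hd _).deriv, intervalIntegral.integral_const, smul_eq_mul] at this
  rw [hv, norm_smul, norm_inv, Real.norm_of_nonneg hba.le, ← mul_assoc,
    mul_inv_cancel₀ hba.ne'] at this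
  linarith

theorem ae_norm_deriv_eq_one (hc : IsMinLoop L c) : ∀ᵐ x, ‖deriv c x‖ = 1 := by
  have key : ∀ q : ℚ, ∀ᵐ x, x ∈ Ioo (q : ℝ) (q + L) → ‖deriv c x‖ = 1 := by
    intro q
    have hqL : (q : ℝ) ≤ q + L := by linarith [hc.pos]
    have h1 := hc.le_integral_norm_deriv hqL le_rfl
    have hi := (hc.lip.lipschitzOnWith (s := Icc (q : ℝ) (q + L))).intervalIntegrable_norm_deriv hqL
    have h2 : ∫ x in (q : ℝ)..(q + L), (1 - ‖deriv c x‖) ≤ 0 := by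
      rw [intervalIntegral.integral_sub (by simp) hi]
      simp only [intervalIntegral.integral_const, smul_eq_mul, mul_one]
      linarith
    have h3 : 0 ≤ᵐ[volume.restrict (Ioc (q : ℝ) (q + L))] fun x => 1 - ‖deriv c x‖ :=
      Filter.Eventually.of_forall fun x => sub_nonneg.2 (hc.norm_deriv_le x)
    have h4 := (intervalIntegral.integral_eq_zero_iff_of_le_of_nonneg_ae hqL h3
      ((intervalIntegrable_const (c := (1 : ℝ))).sub hi)).1
      (le_antisymm h2 (intervalIntegral.integral_nonneg hqL
        fun x _ => sub_nonneg.2 (hc.norm_deriv_le x)))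
    rw [Filter.EventuallyEq, ae_restrict_iff' measurableSet_Ioc] at h4
    filter_upwards [h4] with x hx hxI
    have := hx (Ioo_subset_Ioc_self hxI)
    simp only [Pi.zero_apply] at this
    linarith
  filter_upwards [ae_all_iff.2 key] with x hx
  obtain ⟨q, h1, h2⟩ := exists_rat_btwn (show x - L < x by linarith [hc.pos])
  exact hx q ⟨h2, by linarith⟩

end IsMinLoop

/-- The point `x` lies weakly beyond a supporting plane of the curve `c`. -/
def IsHullPoint (c : ℝ → E3) (x : E3) : Prop :=
  ∃ w : E3, ‖w‖ = 1 ∧ ∀ s, inner ℝ w (c s) ≤ inner ℝ w x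

theorem isClosed_isHullPoint (c : ℝ → E3) : IsClosed {x | IsHullPoint c x} := by
  have h1 : IsClosed {p : Metric.sphere (0 : E3) 1 × E3 |
      ∀ s, inner ℝ (p.1 : E3) (c s) ≤ inner ℝ (p.1 : E3) p.2} := by
    simp only [ofPred_forall]
    exact isClosed_iInter fun s => isClosed_le (by fun_prop) (by fun_prop)
  have h2 := isClosedMap_snd_of_compactSpace _ h1
  convert! h2 using 1
  ext x
  constructor
  · rintro ⟨w, hw, h⟩
    exact ⟨(⟨w, by simpa using hw⟩, x), h, rfl⟩
  · rintro ⟨⟨w, y⟩, h, rfl⟩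
    exact ⟨w, by simp, h⟩

/-- A `1`-Lipschitz curve realizing the distance of its endpoints is a segment. -/
theorem LipschitzOnWith.exists_eq_segment {F : Type*} [NormedAddCommGroup F]
    [InnerProductSpace ℝ F] {g : ℝ → F} {a b : ℝ} (hab : a < b)
    (hg : LipschitzOnWith 1 g (Icc a b)) (h : b - a ≤ ‖g b - g a‖) :
    ∃ u : F, ‖u‖ = 1 ∧ ∀ s ∈ Icc a b, g s = g a + (s - a) • u := by
  have hba : 0 < b - a := sub_pos.2 hab
  have hle : ∀ x ∈ Icc a b, ∀ y ∈ Icc a b, ‖g x - g y‖ ≤ |x - y| := by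
    intro x hx y hy
    simpa [dist_eq_norm] using hg.dist_le_mul x hx y hy
  have ha : a ∈ Icc a b := ⟨le_rfl, hab.le⟩
  have hb : b ∈ Icc a b := ⟨hab.le, le_rfl⟩
  have heq : ‖g b - g a‖ = b - a :=
    le_antisymm ((hle b hb a ha).trans (by rw [abs_of_pos hba])) h
  set u : F := (b - a)⁻¹ • (g b - g a) with hu
  have hu1 : ‖u‖ = 1 := by
    rw [hu, norm_smul, heq, norm_inv, Real.norm_of_nonneg hba.le, inv_mul_cancel₀ hba.ne']
  have hgu : g b - g a = (b - a) • u := by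
    rw [hu, smul_smul, mul_inv_cancel₀ hba.ne', one_smul]
  refine ⟨u, hu1, fun s hs => ?_⟩
  have h1 : inner ℝ u (g s - g a) + inner ℝ u (g b - g s) = b - a := by
    rw [← inner_add_right, show g s - g a + (g b - g s) = g b - g a by abel, hgu,
      real_inner_smul_right, real_inner_self_eq_norm_sq, hu1]
    ring
  have h2 : inner ℝ u (g b - g s) ≤ b - s := by
    refine (real_inner_le_norm _ _).trans ?_
    rw [hu1, one_mul]
    exact (hle b hb s hs).trans (by rw [abs_of_nonneg (by linarith [hs.2])])
  have h3 : ‖g s - g a‖ ≤ s - a :=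
    (hle s hs a ha).trans (by rw [abs_of_nonneg (by linarith [hs.1])])
  have h4 : ‖g s - g a - (s - a) • u‖ ^ 2 ≤ 0 := by
    rw [norm_sub_sq_real, real_inner_smul_right, norm_smul, hu1, real_inner_comm,
      Real.norm_of_nonneg (by linarith [hs.1])]
    have := norm_nonneg (g s - g a)
    nlinarith [hs.1]
  have h5 : ‖g s - g a - (s - a) • u‖ = 0 := by
    have := norm_nonneg (g s - g a - (s - a) • u)
    nlinarith
  rw [norm_eq_zero, sub_eq_zero] at h5
  rw [← h5]
  abel

namespace IsMinLoop

variable {L : ℝ} {c : ℝ → E3}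

theorem one_le_inner (hc : IsMinLoop L c) {w x : E3} (hw : ‖w‖ = 1)
    (h : ∀ s, inner ℝ w (c s) ≤ inner ℝ w x) : 1 ≤ inner ℝ w x := by
  obtain ⟨s, hs⟩ := hc.supp w hw
  exact hs.trans (h s)

theorem one_le_norm_of_isHullPoint (hc : IsMinLoop L c) {x : E3} (h : IsHullPoint c x) :
    1 ≤ ‖x‖ := by
  obtain ⟨w, hw, h⟩ := h
  have := (hc.one_le_inner hw h).trans (real_inner_le_norm w x)
  rwa [hw, one_mul] at this

theorem exists_isMax (hc : IsMinLoop L c) (n : E3) :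
    ∃ s, ∀ s', inner ℝ n (c s') ≤ inner ℝ n (c s) := by
  have hcont : ContinuousOn (fun s => inner ℝ n (c s)) (Icc 0 L) :=
    (continuous_const.inner hc.lip.continuous).continuousOn
  obtain ⟨s, _, h⟩ := isCompact_Icc.exists_isMaxOn (nonempty_Icc.2 hc.pos.le) hcont
  refine ⟨s, fun s' => ?_⟩
  obtain ⟨s'', hs'', e⟩ := hc.exists_mem_Icc_eq 0 s'
  rw [← e]
  exact h ⟨hs''.1, by simpa using hs''.2.le⟩

theorem exists_hullPoint (hc : IsMinLoop L c) (n : E3) (hn : ‖n‖ = 1) :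
    ∃ s, IsHullPoint c (c s) ∧ 1 ≤ inner ℝ n (c s) := by
  obtain ⟨s, h⟩ := hc.exists_isMax n
  exact ⟨s, ⟨n, hn, h⟩, hc.one_le_inner hn h⟩

/-- An arc whose hull points are repeated on the rest of the loop is straight. -/
theorem chord_of_hullPoint (hc : IsMinLoop L c) {a b : ℝ} (hab : a < b) (hbL : b ≤ a + L)
    (h : ∀ s ∈ Ioo a b, IsHullPoint c (c s) → ∃ s' ∈ Icc b (a + L), c s' = c s) :
    ‖c b - c a‖ = b - a := by
  refine hc.chord hab hbL fun n hn _ => ?_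
  obtain ⟨s, hs, h1⟩ := hc.exists_hullPoint n hn
  obtain ⟨s', hs', e⟩ := hc.exists_mem_Icc_eq a s
  rw [← e] at hs h1
  rcases eq_or_lt_of_le hs'.1 with rfl | hlt
  · exact ⟨a + L, ⟨hbL, le_rfl⟩, by rwa [hc.periodic]⟩
  rcases le_or_gt b s' with hb | hb
  · exact ⟨s', ⟨hb, hs'.2.le⟩, h1⟩
  · obtain ⟨s'', hs'', e'⟩ := h s' ⟨hlt, hb⟩ hs
    exact ⟨s'', hs'', by rwa [e']⟩

theorem exists_straight (hc : IsMinLoop L c) {t : ℝ} (ht : ¬ IsHullPoint c (c t)) :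
    ∃ ε > 0, ∃ u : E3, ‖u‖ = 1 ∧ ∀ s ∈ Icc (t - ε) (t + ε), c s = c t + (s - t) • u := by
  have hopen : IsOpen {s | ¬ IsHullPoint c (c s)} :=
    (isClosed_isHullPoint c).isOpen_compl.preimage hc.lip.continuous
  obtain ⟨ε, hε, h⟩ := Metric.isOpen_iff.1 hopen t ht
  set d := min (ε / 2) (L / 2) with hd
  have hd0 : 0 < d := lt_min (by linarith) (by linarith [hc.pos])
  have hd1 : d ≤ ε / 2 := min_le_left _ _
  have hd2 : d ≤ L / 2 := min_le_right _ _
  have h1 := hc.chord_of_hullPoint (a := t - d) (b := t + d) (by linarith) (by linarith)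
    (fun s hs hB => absurd hB (h (by
      rw [Metric.mem_ball, Real.dist_eq, abs_lt]
      constructor <;> linarith [hs.1, hs.2])))
  obtain ⟨u, hu, hs⟩ := (hc.lip.lipschitzOnWith (s := Icc (t - d) (t + d))).exists_eq_segment
    (by linarith) h1.ge
  refine ⟨d, hd0, u, hu, fun s hsI => ?_⟩
  rw [hs s hsI, hs t ⟨by linarith, by linarith⟩, add_assoc, ← add_smul]
  congr 2
  ring

theorem not_isHullPoint_of_norm_lt (hc : IsMinLoop L c) {x : E3} (h : ‖x‖ < 1) :
    ¬ IsHullPoint c x := fun hB => absurd (hc.one_le_norm_of_isHullPoint hB) (not_le.2 h)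

end IsMinLoop

theorem exists_last_eq {H : ℝ → ℝ} {a x d : ℝ} (hax : a ≤ x) (hH : ContinuousOn H (Icc a x))
    (ha : d ≤ H a) (hx : H x < d) :
    ∃ a' ∈ Ico a x, H a' = d ∧ ∀ s ∈ Ioc a' x, H s < d := by
  have hcl : IsClosed {s ∈ Icc a x | d ≤ H s} := by
    have := hH.preimage_isClosed_of_isClosed isClosed_Icc (isClosed_Ici (a := d))
    exact this
  have hcomp : IsCompact {s ∈ Icc a x | d ≤ H s} :=
    isCompact_Icc.of_isClosed_subset hcl (fun s hs => hs.1)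
  obtain ⟨m, ⟨hm1, hm2⟩, hm⟩ := hcomp.exists_isGreatest ⟨a, ⟨le_rfl, hax⟩, ha⟩
  have hlt : ∀ s ∈ Ioc m x, H s < d := by
    intro s hs
    by_contra! h
    exact absurd (hm ⟨⟨hm1.1.trans hs.1.le, hs.2⟩, h⟩) (not_le.2 hs.1)
  have hmx : m < x := lt_of_le_of_ne hm1.2 fun h => by
    rw [h] at hm2
    exact absurd hm2 (not_le.2 hx)
  refine ⟨m, ⟨hm1.1, hmx⟩, le_antisymm ?_ hm2, hlt⟩
  obtain ⟨s, hs, h⟩ := intermediate_value_Icc' hm1.2 (hH.mono (Icc_subset_Icc_left hm1.1))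
    (show d ∈ Icc (H x) (H m) from ⟨hx.le, hm2⟩)
  rcases eq_or_lt_of_le hs.1 with e | e
  · rw [e, h]
  · exact absurd h (hlt s ⟨e, hs.2⟩).ne

theorem exists_first_eq {H : ℝ → ℝ} {x b d : ℝ} (hxb : x ≤ b) (hH : ContinuousOn H (Icc x b))
    (hb : d ≤ H b) (hx : H x < d) :
    ∃ b' ∈ Ioc x b, H b' = d ∧ ∀ s ∈ Ico x b', H s < d := by
  obtain ⟨a', ha', h1, h2⟩ := exists_last_eq (H := fun s => H (-s)) (a := -b) (x := -x) (d := d)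
    (by linarith) (hH.comp continuousOn_neg fun s hs => ⟨by linarith [hs.2], by linarith [hs.1]⟩)
    (by simpa) (by simpa)
  refine ⟨-a', ⟨by linarith [ha'.2], by linarith [ha'.1]⟩, h1, fun s hs => ?_⟩
  simpa using h2 (-s) ⟨by linarith [hs.2], by linarith [hs.1]⟩

section Polar

variable {F : Type*} [NormedAddCommGroup F] [InnerProductSpace ℝ F]

theorem norm_normalize_sub_le {x y : F} (hx : x ≠ 0) (hy : y ≠ 0) :
    ‖‖x‖⁻¹ • x - ‖y‖⁻¹ • y‖ ≤ 2 * ‖x‖⁻¹ * ‖x - y‖ := by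
  have hx' : 0 < ‖x‖ := norm_pos_iff.2 hx
  have hy' : 0 < ‖y‖ := norm_pos_iff.2 hy
  have e : ‖x‖⁻¹ • x - ‖y‖⁻¹ • y = ‖x‖⁻¹ • (x - y) + (‖x‖⁻¹ - ‖y‖⁻¹) • y := by
    rw [smul_sub, sub_smul]; abel
  have h1 : ‖(‖x‖⁻¹ - ‖y‖⁻¹) • y‖ ≤ ‖x‖⁻¹ * ‖x - y‖ := by
    rw [norm_smul, inv_sub_inv hx'.ne' hy'.ne', norm_div, norm_mul, norm_norm, norm_norm,
      Real.norm_eq_abs, div_mul_eq_mul_div, mul_div_mul_right _ _ hy'.ne', div_eq_inv_mul,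
      norm_sub_rev x y]
    gcongr
    exact abs_norm_sub_norm_le y x
  rw [e]
  refine (norm_add_le _ _).trans ?_
  rw [norm_smul, norm_inv, norm_norm]
  linarith

theorem norm_smul_normalize {x : F} (hx : x ≠ 0) : ‖x‖ • (‖x‖⁻¹ • x) = x := by
  rw [smul_smul, mul_inv_cancel₀ (norm_ne_zero_iff.2 hx), one_smul]

theorem norm_normalize {x : F} (hx : x ≠ 0) : ‖‖x‖⁻¹ • x‖ = 1 := by
  rw [norm_smul, norm_inv, norm_norm, inv_mul_cancel₀ (norm_ne_zero_iff.2 hx)]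

/-- The speed of a curve in polar form. -/
theorem norm_deriv_smul_sq {e : ℝ → F} {ρ : ℝ → ℝ} {x ρ' : ℝ} {e' : F} (hρ : HasDerivAt ρ ρ' x)
    (he : HasDerivAt e e' x) (h1 : ∀ᶠ s in nhds x, ‖e s‖ = 1) :
    ‖deriv (fun s => ρ s • e s) x‖ ^ 2 = ρ' ^ 2 + ρ x ^ 2 * ‖e'‖ ^ 2 := by
  have hd := hρ.fun_smul he
  have horth : inner ℝ (e x) e' = 0 := by
    have h2 := he.norm_sq
    have h3 : (fun s => ‖e s‖ ^ 2) =ᶠ[nhds x] fun _ => (1 : ℝ) := by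
      filter_upwards [h1] with s hs
      rw [hs, one_pow]
    have h4 := h3.deriv_eq
    rw [h2.deriv, deriv_const] at h4
    linarith
  rw [hd.deriv, norm_add_sq_real, real_inner_smul_left, real_inner_smul_right, real_inner_comm,
    horth, norm_smul, norm_smul, h1.self_of_nhds]
  simp only [Real.norm_eq_abs, mul_pow, sq_abs]
  ring

end Polar

/-- The planar curve with polar coordinates `(r, θ)`. -/
def polarCurve (r θ : ℝ → ℝ) (s : ℝ) : ℂ := (r s : ℂ) * Complex.exp (Complex.I * (θ s : ℂ))

theorem hasDerivAt_exp_I_mul {θ : ℝ → ℝ} {x θ' : ℝ} (h : HasDerivAt θ θ' x) :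
    HasDerivAt (fun s => Complex.exp (Complex.I * (θ s : ℂ)))
      (θ' • (Complex.I * Complex.exp (Complex.I * (θ x : ℂ)))) x := by
  have := ((h.ofReal_comp).const_mul Complex.I).cexp
  convert! this using 1
  rw [Complex.real_smul]
  ring

theorem norm_exp_I_mul (t : ℝ) : ‖Complex.exp (Complex.I * (t : ℂ))‖ = 1 := by
  rw [mul_comm, Complex.norm_exp_ofReal_mul_I]

theorem norm_deriv_polarCurve_sq {r θ : ℝ → ℝ} {x r' θ' : ℝ} (hr : HasDerivAt r r' x)
    (hθ : HasDerivAt θ θ' x) :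
    ‖deriv (polarCurve r θ) x‖ ^ 2 = r' ^ 2 + r x ^ 2 * θ' ^ 2 := by
  have h := norm_deriv_smul_sq hr (hasDerivAt_exp_I_mul hθ)
    (Filter.Eventually.of_forall fun s => norm_exp_I_mul (θ s))
  rw [norm_smul, norm_mul, Complex.norm_I, norm_exp_I_mul, mul_one, mul_one, Real.norm_eq_abs,
    sq_abs] at h
  rw [← h]
  rfl

theorem IsMinLoop.exists_lipschitzOnWith_normalize {L : ℝ} {c : ℝ → E3} {p : E3} {α β : ℝ}
    (hc : IsMinLoop L c) (hαβ : α ≤ β) (hne : ∀ s ∈ Icc α β, c s ≠ p) :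
    ∃ K : NNReal, LipschitzOnWith K (fun u => ‖c u - p‖⁻¹ • (c u - p)) (Icc α β) := by
  have hcont : ContinuousOn (fun s => ‖c s - p‖) (Icc α β) :=
    ((hc.lip.continuous.sub continuous_const).norm).continuousOn
  obtain ⟨m, hm, hmin⟩ := isCompact_Icc.exists_isMinOn (nonempty_Icc.2 hαβ) hcont
  have hmpos : 0 < ‖c m - p‖ := norm_pos_iff.2 (sub_ne_zero.2 (hne m hm))
  refine ⟨⟨2 * ‖c m - p‖⁻¹, by positivity⟩, LipschitzOnWith.of_dist_le_mul fun x hx y hy => ?_⟩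
  rw [dist_eq_norm, Real.dist_eq]
  refine (norm_normalize_sub_le (sub_ne_zero.2 (hne x hx)) (sub_ne_zero.2 (hne y hy))).trans ?_
  have h1 : ‖c m - p‖ ≤ ‖c x - p‖ := hmin hx
  have h2 := hc.norm_sub_le x y
  rw [sub_sub_sub_cancel_right]
  show _ ≤ 2 * ‖c m - p‖⁻¹ * |x - y|
  gcongr

/-- Polar coordinates of the arc of `c` over `[α, β]` around the apex `p`: the angle `θ` is the
arclength of the radial projection. -/
structure IsPolarArc (c : ℝ → E3) (p : E3) (α β : ℝ) (θ : ℝ → ℝ) : Prop where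
  le : α ≤ β
  ne : ∀ s ∈ Icc α β, c s ≠ p
  angle : ∀ x ∈ Icc α β, ∀ y ∈ Icc α β, x ≤ y →
    θ y - θ x = ∫ s in x..y, ‖deriv (fun u => ‖c u - p‖⁻¹ • (c u - p)) s‖

namespace IsPolarArc

variable {L : ℝ} {c : ℝ → E3} {p : E3} {α β : ℝ} {θ : ℝ → ℝ}

theorem mono (h : IsPolarArc c p α β θ) {α' β' : ℝ} (hα : α ≤ α') (hαβ : α' ≤ β') (hβ : β' ≤ β) :
    IsPolarArc c p α' β' θ where
  le := hαβ
  ne := fun s hs => h.ne s (Icc_subset_Icc hα hβ hs)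
  angle := fun x hx y hy => h.angle x (Icc_subset_Icc hα hβ hx) y (Icc_subset_Icc hα hβ hy)

theorem exists_lipschitz (h : IsPolarArc c p α β θ) (hc : IsMinLoop L c) :
    ∃ K : NNReal, LipschitzOnWith K (fun u => ‖c u - p‖⁻¹ • (c u - p)) (Icc α β) :=
  hc.exists_lipschitzOnWith_normalize h.le h.ne

theorem monotoneOn (h : IsPolarArc c p α β θ) : MonotoneOn θ (Icc α β) := by
  intro x hx y hy hxy
  have := h.angle x hx y hy hxy
  have h2 : 0 ≤ ∫ s in x..y, ‖deriv (fun u => ‖c u - p‖⁻¹ • (c u - p)) s‖ :=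
    intervalIntegral.integral_nonneg hxy fun _ _ => norm_nonneg _
  linarith

theorem exists_lipschitz_angle (h : IsPolarArc c p α β θ) (hc : IsMinLoop L c) :
    ∃ K : NNReal, LipschitzOnWith K θ (Icc α β) := by
  obtain ⟨K, hK⟩ := h.exists_lipschitz hc
  refine ⟨K, LipschitzOnWith.of_le_add_mul K fun x hx y hy => ?_⟩
  rcases le_total x y with hxy | hxy
  · have := h.monotoneOn hx hy hxy
    have h2 : 0 ≤ (K : ℝ) * dist x y := by positivity
    linarith
  · have h1 := h.angle y hy x hx hxy
    have hK' := hK.mono (Icc_subset_Icc hy.1 hx.2)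
    have h2 := integral_le_of_ae_le hxy (hK'.intervalIntegrable_norm_deriv hxy)
      (intervalIntegrable_const (c := (K : ℝ)))
      (Filter.Eventually.of_forall fun s hs => hK'.norm_deriv_le_Icc hs)
    simp only [intervalIntegral.integral_const, smul_eq_mul] at h2
    rw [Real.dist_eq, abs_of_nonneg (by linarith)]
    linarith

theorem norm_sub_le_angle (h : IsPolarArc c p α β θ) (hc : IsMinLoop L c) {x y : ℝ}
    (hx : x ∈ Icc α β) (hy : y ∈ Icc α β) (hxy : x ≤ y) :
    ‖‖c y - p‖⁻¹ • (c y - p) - ‖c x - p‖⁻¹ • (c x - p)‖ ≤ θ y - θ x := by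
  obtain ⟨K, hK⟩ := h.exists_lipschitz hc
  rw [h.angle x hx y hy hxy]
  exact (hK.mono (Icc_subset_Icc hx.1 hy.2)).norm_sub_le_integral hxy

theorem ae_hasDerivAt_angle (h : IsPolarArc c p α β θ) (hc : IsMinLoop L c) :
    ∀ᵐ x, x ∈ Ioo α β →
      HasDerivAt θ ‖deriv (fun u => ‖c u - p‖⁻¹ • (c u - p)) x‖ x := by
  obtain ⟨K, hK⟩ := h.exists_lipschitz hc
  filter_upwards [(hK.intervalIntegrable_norm_deriv h.le).ae_hasDerivAt_integral] with x hx hxI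
  rw [uIcc_of_le h.le] at hx
  have h1 := (hx (Ioo_subset_Icc_self hxI) α ⟨le_rfl, h.le⟩).add_const (θ α)
  refine h1.congr_of_eventuallyEq ?_
  filter_upwards [Icc_mem_nhds hxI.1 hxI.2] with s hs
  rw [← h.angle α ⟨le_rfl, h.le⟩ s hs hs.1]
  ring

end IsPolarArc

theorem exists_lipschitzOnWith_smul {F : Type*} [NormedAddCommGroup F] [NormedSpace ℝ F]
    {A : ℝ → ℝ} {B : ℝ → F} {K₁ K₂ : NNReal} {a b : ℝ} (hab : a ≤ b)
    (hA : LipschitzOnWith K₁ A (Icc a b)) (hB : LipschitzOnWith K₂ B (Icc a b)) :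
    ∃ K : NNReal, LipschitzOnWith K (fun s => A s • B s) (Icc a b) := by
  obtain ⟨M, hM⟩ := isCompact_Icc.exists_bound_of_continuousOn hA.continuousOn
  obtain ⟨N, hN⟩ := isCompact_Icc.exists_bound_of_continuousOn hB.continuousOn
  have hM0 : 0 ≤ M := (norm_nonneg _).trans (hM a ⟨le_rfl, hab⟩)
  have hN0 : 0 ≤ N := (norm_nonneg _).trans (hN a ⟨le_rfl, hab⟩)
  refine ⟨⟨M * K₂ + K₁ * N, by positivity⟩, LipschitzOnWith.of_dist_le_mul fun x hx y hy => ?_⟩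
  have e : A x • B x - A y • B y = A x • (B x - B y) + (A x - A y) • B y := by
    rw [smul_sub, sub_smul]; abel
  rw [dist_eq_norm, e]
  refine (norm_add_le _ _).trans ?_
  rw [norm_smul, norm_smul]
  have h1 := hA.dist_le_mul x hx y hy
  have h2 := hB.dist_le_mul x hx y hy
  rw [dist_eq_norm] at h1 h2
  show _ ≤ (M * K₂ + K₁ * N) * dist x y
  have h3 := mul_le_mul (hM x hx) h2 (norm_nonneg _) hM0
  have h4 := mul_le_mul h1 (hN y hy) (norm_nonneg _) (by positivity)
  linarith

theorem exp_mul_polarCurve (r θ : ℝ → ℝ) (φ s : ℝ) :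
    Complex.exp (-(Complex.I * φ)) * polarCurve r θ s =
      ⟨r s * cos (θ s - φ), r s * sin (θ s - φ)⟩ := by
  have h : Complex.exp (-(Complex.I * φ)) * polarCurve r θ s =
      (r s : ℂ) * Complex.exp (((θ s - φ : ℝ) : ℂ) * Complex.I) := by
    rw [polarCurve, mul_left_comm, ← Complex.exp_add]
    congr 2
    push_cast
    ring
  rw [h, Complex.exp_mul_I, ← Complex.ofReal_cos, ← Complex.ofReal_sin]
  apply Complex.ext <;>
    simp only [Complex.re_ofReal_mul, Complex.im_ofReal_mul, Complex.add_re, Complex.add_im,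
      Complex.re_ofReal_mul, Complex.im_ofReal_mul, Complex.I_re, Complex.I_im, Complex.ofReal_re,
      Complex.ofReal_im] <;>
    ring

namespace IsPolarArc

variable {L : ℝ} {c : ℝ → E3} {p : E3} {α β : ℝ} {θ : ℝ → ℝ}

theorem norm_sub_radius_le (hc : IsMinLoop L c) (p : E3) :
    LipschitzWith 1 fun s => ‖c s - p‖ := by
  refine LipschitzWith.of_dist_le_mul fun x y => ?_
  rw [Real.dist_eq, Real.dist_eq]
  refine (abs_norm_sub_norm_le _ _).trans ?_
  simpa using hc.norm_sub_le x y

/-- Speeds of curves with the same angular part as `c`. -/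
theorem ae_speed (h : IsPolarArc c p α β θ) (hc : IsMinLoop L c) {K : NNReal} {ρ : ℝ → ℝ}
    (hρ : LipschitzOnWith K ρ (Icc α β)) :
    ∀ᵐ x, x ∈ Ioo α β → DifferentiableAt ℝ ρ x ∧ DifferentiableAt ℝ θ x ∧ 0 ≤ deriv θ x ∧
      ‖deriv (fun s => p + ρ s • (‖c s - p‖⁻¹ • (c s - p))) x‖ ^ 2 =
        deriv ρ x ^ 2 + ρ x ^ 2 * deriv θ x ^ 2 := by
  obtain ⟨K', hK'⟩ := h.exists_lipschitz hc
  filter_upwards [h.ae_hasDerivAt_angle hc, hρ.ae_differentiableAt_Icc,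
    hK'.ae_differentiableAt_Icc] with x h1 h2 h3 hx
  have hθ := h1 hx
  refine ⟨h2 hx, hθ.differentiableAt, ?_, ?_⟩
  · rw [hθ.deriv]
    exact norm_nonneg _
  · rw [deriv_const_add]
    rw [norm_deriv_smul_sq (h2 hx).hasDerivAt (h3 hx).hasDerivAt ?_, hθ.deriv]
    filter_upwards [Icc_mem_nhds hx.1 hx.2] with s hs
    exact norm_normalize (sub_ne_zero.2 (h.ne s hs))

theorem self_eq (h : IsPolarArc c p α β θ) {s : ℝ} (hs : s ∈ Icc α β) :
    p + ‖c s - p‖ • (‖c s - p‖⁻¹ • (c s - p)) = c s := by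
  rw [norm_smul_normalize (sub_ne_zero.2 (h.ne s hs))]
  abel

theorem exists_lipschitz_polarCurve (h : IsPolarArc c p α β θ) (hc : IsMinLoop L c) :
    ∃ K : NNReal, LipschitzOnWith K (polarCurve (fun s => ‖c s - p‖) θ) (Icc α β) := by
  obtain ⟨K, hK⟩ := h.exists_lipschitz_angle hc
  have hE : LipschitzWith 1 fun t : ℝ => Complex.exp (Complex.I * (t : ℂ)) := by
    refine lipschitzWith_of_nnnorm_deriv_le
      (fun x => (hasDerivAt_exp_I_mul (hasDerivAt_id x)).differentiableAt) fun x => ?_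
    have := (hasDerivAt_exp_I_mul (hasDerivAt_id x)).deriv
    simp only [id] at this
    rw [this, one_smul, nnnorm_mul, Complex.nnnorm_I, one_mul, Complex.nnnorm_exp_I_mul_ofReal]
  obtain ⟨K', hK'⟩ := exists_lipschitzOnWith_smul h.le
    ((norm_sub_radius_le hc p).lipschitzOnWith (s := Icc α β)) (hE.comp_lipschitzOnWith hK)
  refine ⟨K', ?_⟩
  simpa only [Complex.real_smul, Function.comp_def] using! hK'

theorem ae_speed_polarCurve (h : IsPolarArc c p α β θ) (hc : IsMinLoop L c) :
    ∀ᵐ x, x ∈ Ioo α β → ‖deriv (polarCurve (fun s => ‖c s - p‖) θ) x‖ = 1 := by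
  filter_upwards [h.ae_speed hc ((norm_sub_radius_le hc p).lipschitzOnWith (s := Icc α β)),
    hc.ae_norm_deriv_eq_one] with x h1 h2 hx
  obtain ⟨hr, hθ, h0, hE⟩ := h1 hx
  have h3 := norm_deriv_polarCurve_sq hr.hasDerivAt hθ.hasDerivAt
  rw [← hE] at h3
  have h4 : (fun s => p + ‖c s - p‖ • (‖c s - p‖⁻¹ • (c s - p))) =ᶠ[nhds x] c := by
    filter_upwards [Icc_mem_nhds hx.1 hx.2] with s hs using h.self_eq hs
  rw [h4.deriv_eq, h2] at h3
  have := norm_nonneg (deriv (polarCurve (fun s => ‖c s - p‖) θ) x)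
  nlinarith

theorem lipschitz_polarCurve (h : IsPolarArc c p α β θ) (hc : IsMinLoop L c) :
    LipschitzOnWith 1 (polarCurve (fun s => ‖c s - p‖) θ) (Icc α β) := by
  obtain ⟨K, hK⟩ := h.exists_lipschitz_polarCurve hc
  have key : ∀ x ∈ Icc α β, ∀ y ∈ Icc α β, x ≤ y →
      dist (polarCurve (fun s => ‖c s - p‖) θ x) (polarCurve (fun s => ‖c s - p‖) θ y)
        ≤ dist x y := by
    intro x hx y hy hxy
    have h1 := (hK.mono (Icc_subset_Icc hx.1 hy.2)).norm_sub_le_of_ae (C := 1) hxy (by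
      filter_upwards [h.ae_speed_polarCurve hc] with s hs hsI
      exact (hs ⟨hx.1.trans_lt hsI.1, hsI.2.trans_le hy.2⟩).le)
    rw [dist_comm, dist_eq_norm, dist_comm x, Real.dist_eq, abs_of_nonneg (by linarith)]
    linarith
  refine LipschitzOnWith.of_dist_le_mul fun x hx y hy => ?_
  rw [NNReal.coe_one, one_mul]
  rcases le_total x y with hxy | hxy
  · exact key x hx y hy hxy
  · rw [dist_comm, dist_comm x]
    exact key y hy x hx hxy

/-- The local convexity estimate: on an arc seen from an apex `p` inside the unit ball, the
distances of the planar development to a line separating it from the origin have no interior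
dips. -/
theorem le_of_le (h : IsPolarArc c p α β θ) (hc : IsMinLoop L c) (hp : ‖p‖ < 1)
    (hβ : β ≤ α + L) {a x b φ d : ℝ} (ha : a ∈ Icc α β) (hb : b ∈ Icc α β) (hax : a ≤ x)
    (hxb : x ≤ b) (hφa : -(π / 2) < θ a - φ) (hφb : θ b - φ < π / 2) (hd : 0 < d)
    (hHa : d ≤ ‖c a - p‖ * cos (θ a - φ)) (hHb : d ≤ ‖c b - p‖ * cos (θ b - φ)) :
    d ≤ ‖c x - p‖ * cos (θ x - φ) := by
  by_contra! hlt
  set H : ℝ → ℝ := fun s => ‖c s - p‖ * cos (θ s - φ) with hH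
  obtain ⟨Kθ, hθ⟩ := h.exists_lipschitz_angle hc
  have hHc : ContinuousOn H (Icc α β) :=
    (norm_sub_radius_le hc p).continuous.continuousOn.mul
      (continuous_cos.comp_continuousOn (hθ.continuousOn.sub continuousOn_const))
  obtain ⟨a', ha', hHa', hlta⟩ := exists_last_eq hax
    (hHc.mono (Icc_subset_Icc ha.1 (hxb.trans hb.2))) hHa hlt
  obtain ⟨b', hb', hHb', hltb⟩ := exists_first_eq hxb
    (hHc.mono (Icc_subset_Icc (ha.1.trans hax) hb.2)) hHb hlt
  have hab' : a' < b' := ha'.2.trans hb'.1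
  have hαa' : α ≤ a' := ha.1.trans ha'.1
  have hb'β : b' ≤ β := hb'.2.trans hb.2
  have h' := h.mono hαa' hab'.le hb'β
  have hle : ∀ s ∈ Icc a' b', H s ≤ d := by
    intro s hs
    rcases eq_or_lt_of_le hs.1 with e | e
    · rw [← e, hHa']
    rcases eq_or_lt_of_le hs.2 with e' | e'
    · rw [e', hHb']
    rcases le_total s x with hsx | hsx
    · exact (hlta s ⟨e, hsx⟩).le
    · exact (hltb s ⟨hsx, e'⟩).le
  have ha'm : a' ∈ Icc a' b' := ⟨le_rfl, hab'.le⟩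
  have hb'm : b' ∈ Icc a' b' := ⟨hab'.le, le_rfl⟩
  have hmap : MapsTo (fun s => θ s - φ) (Icc a' b') (Icc (θ a' - φ) (θ b' - φ)) := fun s hs =>
    ⟨sub_le_sub_right (h'.monotoneOn ha'm hs hs.1) _,
      sub_le_sub_right (h'.monotoneOn hs hb'm hs.2) _⟩
  have hsub : Icc (θ a' - φ) (θ b' - φ) ⊆ Ioo (-(π / 2)) (π / 2) := by
    have h1 := h.monotoneOn ha ⟨hαa', hab'.le.trans hb'β⟩ ha'.1
    have h2 := h.monotoneOn ⟨hαa'.trans hab'.le, hb'β⟩ hb hb'.2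
    exact fun u hu => ⟨by linarith [hu.1], by linarith [hu.2]⟩
  have hcos : ∀ s ∈ Icc a' b', 0 < cos (θ s - φ) := fun s hs =>
    cos_pos_of_mem_Ioo (hsub (hmap hs))
  have hu : LipschitzOnWith Kθ (fun s => θ s - φ) (Icc a' b') := by
    intro s hs s' hs'
    rw [edist_sub_right]
    exact hθ (Icc_subset_Icc hαa' hb'β hs) (Icc_subset_Icc hαa' hb'β hs')
  have hG : ContDiffOn ℝ 1 (fun u => d / cos u) (Icc (θ a' - φ) (θ b' - φ)) :=
    contDiffOn_const.div contDiff_cos.contDiffOn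
      fun u hu => (cos_pos_of_mem_Ioo (hsub hu)).ne'
  have hT : ContDiffOn ℝ 1 (fun u => d * tan u) (Icc (θ a' - φ) (θ b' - φ)) := by
    simp only [tan_eq_sin_div_cos]
    exact contDiffOn_const.mul (contDiff_sin.contDiffOn.div contDiff_cos.contDiffOn
      fun u hu => (cos_pos_of_mem_Ioo (hsub hu)).ne')
  obtain ⟨KG, hKG⟩ := hG.exists_lipschitzOnWith one_ne_zero (convex_Icc _ _) isCompact_Icc
  obtain ⟨KT, hKT⟩ := hT.exists_lipschitzOnWith one_ne_zero (convex_Icc _ _) isCompact_Icc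
  set ρ : ℝ → ℝ := fun s => d / cos (θ s - φ) with hρdef
  set τ : ℝ → ℝ := fun s => d * tan (θ s - φ) with hτdef
  have hρ : LipschitzOnWith (KG * Kθ) ρ (Icc a' b') := hKG.comp hu hmap
  have hτ : LipschitzOnWith (KT * Kθ) τ (Icc a' b') := hKT.comp hu hmap
  obtain ⟨Ke, hKe⟩ := h'.exists_lipschitz hc
  obtain ⟨Kδ, hKδ⟩ := exists_lipschitzOnWith_smul hab'.le hρ hKe
  have hδ : LipschitzOnWith Kδ (fun s => p + ρ s • (‖c s - p‖⁻¹ • (c s - p))) (Icc a' b') := by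
    intro s hs s' hs'
    rw [edist_add_left]
    exact hKδ hs hs'
  have hend : ∀ s ∈ Icc a' b', H s = d → ρ s = ‖c s - p‖ := by
    intro s hs e
    rw [hρdef]
    simp only
    rw [← e, hH]
    exact mul_div_cancel_right₀ _ (hcos s hs).ne'
  have hcomp := hc.competitor one_pos hab'.le (by linarith [hb'β, hαa']) hδ
    (by rw [hend a' ha'm hHa', h'.self_eq ha'm]) (by rw [hend b' hb'm hHb', h'.self_eq hb'm])
    (fun n hn => by
      rcases hc.supp_cases a' b' n hn with h1 | ⟨s, hs, h1⟩
      · exact Or.inl h1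
      · refine Or.inr ⟨s, hs, ?_⟩
        have hnp : inner ℝ n p < 1 := by
          refine lt_of_le_of_lt (real_inner_le_norm n p) ?_
          rwa [hn, one_mul]
        have hrρ : ‖c s - p‖ ≤ ρ s := by
          rw [hρdef]
          simp only
          rw [le_div_iff₀ (hcos s hs)]
          exact hle s hs
        rw [← h'.self_eq hs] at h1
        rw [inner_add_right, real_inner_smul_right] at h1 ⊢
        set z := inner ℝ n (‖c s - p‖⁻¹ • (c s - p))
        have hz : 0 < z := by
          by_contra! hz
          nlinarith [norm_nonneg (c s - p)]
        nlinarith)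
  have hint : ∫ s in a'..b', ‖deriv (fun s => p + ρ s • (‖c s - p‖⁻¹ • (c s - p))) s‖
      ≤ τ b' - τ a' := by
    have hac : AbsolutelyContinuousOnInterval τ a' b' := by
      refine LipschitzOnWith.absolutelyContinuousOnInterval (K := KT * Kθ) ?_
      rwa [uIcc_of_le hab'.le]
    rw [← hac.integral_deriv_eq_sub]
    refine integral_le_of_ae_le hab'.le (hδ.intervalIntegrable_norm_deriv hab'.le)
      hac.intervalIntegrable_deriv ?_
    filter_upwards [h'.ae_speed hc hρ] with s hs hsI
    obtain ⟨-, h2, h3, h4⟩ := hs hsI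
    have hcs := hcos s (Ioo_subset_Icc_self hsI)
    have hud : HasDerivAt (fun s => θ s - φ) (deriv θ s) s := h2.hasDerivAt.sub_const φ
    have hτ' : HasDerivAt τ (d * (1 / cos (θ s - φ) ^ 2 * deriv θ s)) s :=
      (HasDerivAt.comp s (h₂ := Real.tan) (h := fun s => θ s - φ)
        (Real.hasDerivAt_tan hcs.ne') hud).const_mul d
    have hρ' : HasDerivAt ρ (-(d * (-sin (θ s - φ) * deriv θ s)) / cos (θ s - φ) ^ 2) s := by
      have := (hasDerivAt_const s d).div (hud.cos) hcs.ne'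
      simpa using! this
    rw [hτ'.deriv]
    refine le_of_sq_le_sq ?_ (by positivity)
    rw [h4, hρ'.deriv]
    have hsc := sin_sq_add_cos_sq (θ s - φ)
    refine le_of_eq ?_
    rw [hρdef]
    field_simp
    linear_combination (deriv θ s ^ 2) * hsc
  set σ : ℝ → ℂ := polarCurve (fun s => ‖c s - p‖) θ with hσ
  have hre : ∀ s, (Complex.exp (-(Complex.I * φ)) * σ s).re = H s := fun s => by
    rw [hσ, exp_mul_polarCurve]
  have him : ∀ s ∈ Icc a' b', H s = d → (Complex.exp (-(Complex.I * φ)) * σ s).im = τ s := by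
    intro s hs e
    rw [hσ, exp_mul_polarCurve]
    simp only [hτdef, tan_eq_sin_div_cos]
    rw [← hend s hs e, hρdef]
    simp only
    ring
  have hnorm : ‖Complex.exp (-(Complex.I * (φ : ℂ)))‖ = 1 := by
    have := norm_exp_I_mul (-φ)
    rwa [Complex.ofReal_neg, mul_neg] at this
  have hlong : b' - a' ≤ ‖σ b' - σ a'‖ := by
    have h1 := Complex.im_le_norm (Complex.exp (-(Complex.I * φ)) * (σ b' - σ a'))
    rw [norm_mul, hnorm, one_mul, mul_sub, Complex.sub_im, him b' hb'm hHb', him a' ha'm hHa']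
      at h1
    linarith
  obtain ⟨w, -, hw⟩ := (h'.lipschitz_polarCurve hc).exists_eq_segment hab' hlong
  have hlin : ∀ s ∈ Icc a' b',
      H s = d + (s - a') * (Complex.exp (-(Complex.I * φ)) * w).re := by
    intro s hs
    rw [← hre s, hσ, hw s hs, ← hσ, mul_add, Complex.add_re, hre, hHa', mul_smul_comm,
      Complex.real_smul, Complex.re_ofReal_mul]
  have h1 := hlin b' hb'm
  rw [hHb'] at h1
  have h2 : (Complex.exp (-(Complex.I * φ)) * w).re = 0 := by
    have : (b' - a') * (Complex.exp (-(Complex.I * φ)) * w).re = 0 := by linarith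
    exact (mul_eq_zero.1 this).resolve_left (by linarith)
  have h3 := hlin x ⟨ha'.2.le, hb'.1.le⟩
  rw [h2, mul_zero, add_zero] at h3
  exact hlt.ne h3

end IsPolarArc

namespace IsPolarArc

variable {L : ℝ} {c : ℝ → E3} {p : E3} {α β : ℝ} {θ : ℝ → ℝ}

/-- Short polar arcs have support lines separating their development from the origin. -/
theorem exists_support (h : IsPolarArc c p α β θ) (hc : IsMinLoop L c) (hp : ‖p‖ < 1)
    (hβ : β ≤ α + L) (hθ : θ β - θ α < π / 2) {t : ℝ} (ht : t ∈ Icc α β) :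
    ∃ φ, 0 ≤ cos (θ t - φ) ∧
      ∀ s ∈ Icc α β, ‖c s - p‖ * cos (θ s - φ) ≤ ‖c t - p‖ * cos (θ t - φ) := by
  have hα' : α ∈ Icc α β := ⟨le_rfl, h.le⟩
  have hβ' : β ∈ Icc α β := ⟨h.le, le_rfl⟩
  have hclosed : ∀ S : Set ℝ,
      IsClosed {φ | ∀ s ∈ S, ‖c s - p‖ * cos (θ s - φ) ≤ ‖c t - p‖ * cos (θ t - φ)} := by
    intro S
    simp only [ofPred_forall]
    exact isClosed_biInter fun s _ => isClosed_le (by fun_prop) (by fun_prop)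
  have hmem : ∀ φ ∈ Icc (θ t - π / 2) (θ t + π / 2), 0 ≤ cos (θ t - φ) := fun φ hφ =>
    cos_nonneg_of_mem_Icc ⟨by linarith [hφ.2], by linarith [hφ.1]⟩
  have hcon := isPreconnected_closed_iff.1 (isPreconnected_Icc (a := θ t - π / 2) (b := θ t + π / 2))
    _ _ (hclosed (Icc α t)) (hclosed (Icc t β)) ?_ ?_ ?_
  · obtain ⟨φ, hφ, h1, h2⟩ := hcon
    refine ⟨φ, hmem φ hφ, fun s hs => ?_⟩
    rcases le_total s t with hst | hst
    · exact h1 s ⟨hs.1, hst⟩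
    · exact h2 s ⟨hst, hs.2⟩
  · intro φ hφ
    by_contra hnot
    simp only [mem_union, mem_ofPred_eq, not_or, not_forall, not_le] at hnot
    obtain ⟨⟨a, ha, hHa⟩, b, hb, hHb⟩ := hnot
    have ha' : a ∈ Icc α β := ⟨ha.1, ha.2.trans ht.2⟩
    have hb' : b ∈ Icc α β := ⟨ht.1.trans hb.1, hb.2⟩
    have h0 : 0 ≤ ‖c t - p‖ * cos (θ t - φ) := mul_nonneg (norm_nonneg _) (hmem φ hφ)
    have hθa := h.monotoneOn ha' ht ha.2
    have hθb := h.monotoneOn ht hb' hb.1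
    have hθα := h.monotoneOn hα' ha' ha.1
    have hθβ := h.monotoneOn hb' hβ' hb.2
    have hca : 0 < cos (θ a - φ) := pos_of_mul_pos_right (h0.trans_lt hHa) (norm_nonneg _)
    have hcb : 0 < cos (θ b - φ) := pos_of_mul_pos_right (h0.trans_lt hHb) (norm_nonneg _)
    have hφa : -(π / 2) < θ a - φ := by
      by_contra! hle
      have := cos_nonpos_of_pi_div_two_le_of_le (x := -(θ a - φ)) (by linarith)
        (by linarith [hφ.1, hφ.2])
      rw [cos_neg] at this
      linarith
    have hφb : θ b - φ < π / 2 := by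
      by_contra! hle
      have := cos_nonpos_of_pi_div_two_le_of_le hle (by linarith [hφ.1, hφ.2])
      linarith
    have := h.le_of_le hc hp hβ ha' hb' ha.2 hb.1 hφa hφb (h0.trans_lt (lt_min hHa hHb))
      (min_le_left _ _) (min_le_right _ _)
    exact absurd this (not_le.2 (lt_min hHa hHb))
  · refine ⟨θ t + π / 2, ⟨by linarith [pi_pos], le_rfl⟩, fun s hs => ?_⟩
    have hs' : s ∈ Icc α β := ⟨hs.1, hs.2.trans ht.2⟩
    have h1 := h.monotoneOn hs' ht hs.2
    have h2 := h.monotoneOn hα' hs' hs.1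
    have h3 := h.monotoneOn ht hβ' ht.2
    rw [← sub_sub, ← sub_sub, cos_sub_pi_div_two, cos_sub_pi_div_two, sub_self, sin_zero, mul_zero]
    exact mul_nonpos_of_nonneg_of_nonpos (norm_nonneg _)
      (sin_nonpos_of_nonpos_of_neg_pi_le (by linarith) (by linarith [pi_pos]))
  · refine ⟨θ t - π / 2, ⟨le_rfl, by linarith [pi_pos]⟩, fun s hs => ?_⟩
    have hs' : s ∈ Icc α β := ⟨ht.1.trans hs.1, hs.2⟩
    have h1 := h.monotoneOn ht hs' hs.1
    have h2 := h.monotoneOn hs' hβ' hs.2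
    have h3 := h.monotoneOn hα' ht ht.1
    have e : ∀ x, cos (x - (θ t - π / 2)) = - sin (x - θ t) := fun x => by
      rw [← cos_add_pi_div_two]; ring_nf
    rw [e, e, sub_self, sin_zero, neg_zero, mul_zero]
    exact mul_nonpos_of_nonneg_of_nonpos (norm_nonneg _)
      (neg_nonpos.2 (sin_nonneg_of_nonneg_of_le_pi (by linarith) (by linarith [pi_pos])))

end IsPolarArc

theorem norm_add_smul_le {F : Type*} [NormedAddCommGroup F] [InnerProductSpace ℝ F] {v z : F}
    (hv : ‖v‖ = 1) {ε N : ℝ} (hz : ‖z‖ ≤ N) :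
    ‖v + ε • z‖ ≤ 1 + ε * inner ℝ v z + ε ^ 2 * N ^ 2 := by
  have h1 : ‖v + ε • z‖ ^ 2 = 1 + 2 * (ε * inner ℝ v z) + ε ^ 2 * ‖z‖ ^ 2 := by
    rw [norm_add_sq_real, hv, norm_smul, mul_pow, Real.norm_eq_abs, sq_abs, real_inner_smul_right]
    ring
  have h2 : ‖z‖ ^ 2 ≤ N ^ 2 := pow_le_pow_left₀ (norm_nonneg _) hz 2
  have h3 : ε ^ 2 * ‖z‖ ^ 2 ≤ ε ^ 2 * N ^ 2 := mul_le_mul_of_nonneg_left h2 (sq_nonneg _)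
  have h4 : 0 ≤ ε ^ 2 * N ^ 2 := by positivity
  have h5 := sq_nonneg ‖v + ε • z‖
  refine le_of_sq_le_sq ?_ (by nlinarith)
  nlinarith [sq_nonneg (ε * inner ℝ v z + ε ^ 2 * N ^ 2)]

namespace IsMinLoop

variable {L : ℝ} {c : ℝ → E3}

theorem absolutelyContinuous_norm_sub_sq (hc : IsMinLoop L c) (p : E3) (a b : ℝ) :
    AbsolutelyContinuousOnInterval (fun s => ‖c s - p‖ ^ 2) a b := by
  have h := ((IsPolarArc.norm_sub_radius_le hc p).lipschitzOnWith
    (s := uIcc a b)).absolutelyContinuousOnInterval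
  have := h.mul h
  simpa only [pow_two] using! this

/-- Length of a radial variation of `c` with affine weight. -/
theorem integral_variation_le (hc : IsMinLoop L c) {p : E3} {a b A B ε N : ℝ} (hab : a ≤ b)
    {K : NNReal} {δ : ℝ → E3} (hδ : LipschitzOnWith K δ (Icc a b))
    (hδe : ∀ s ∈ Icc a b, δ s = c s + (ε * (A * s + B)) • (c s - p))
    (hN : ∀ s ∈ Ioo a b, |A| * ‖c s - p‖ + |A * s + B| ≤ N) :
    ∫ s in a..b, ‖deriv δ s‖ ≤ (b - a) + ε * (A * (‖c b - p‖ ^ 2 - ‖c a - p‖ ^ 2) / 2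
      + A * (b ^ 2 - a ^ 2) / 2 + B * (b - a)) + ε ^ 2 * N ^ 2 * (b - a) := by
  set Ψ : ℝ → ℝ := fun s => (ε * A / 2) * ‖c s - p‖ ^ 2 +
    (ε * A / 2 * s ^ 2 + (1 + ε * B + ε ^ 2 * N ^ 2) * s) with hΨ
  have hac : AbsolutelyContinuousOnInterval Ψ a b := by
    refine ((hc.absolutelyContinuous_norm_sub_sq p a b).const_mul (ε * A / 2)).add ?_
    refine ContDiffOn.absolutelyContinuousOnInterval ?_
    exact ContDiff.contDiffOn (by fun_prop)
  have key : ∫ s in a..b, ‖deriv δ s‖ ≤ ∫ s in a..b, deriv Ψ s := by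
    refine integral_le_of_ae_le hab (hδ.intervalIntegrable_norm_deriv hab)
      hac.intervalIntegrable_deriv ?_
    filter_upwards [hc.ae_norm_deriv_eq_one] with s hs hsI
    have hcd : HasDerivAt c (deriv c s) s := by
      refine DifferentiableAt.hasDerivAt ?_
      by_contra hn
      rw [deriv_zero_of_not_differentiableAt hn, norm_zero] at hs
      exact zero_ne_one hs
    have hη : HasDerivAt (fun s : ℝ => ε * (A * s + B)) (ε * A) s := by
      simpa using! (((hasDerivAt_id s).const_mul A).add_const B).const_mul ε
    have hδ' : HasDerivAt δ (deriv c s + ε • (A • (c s - p) + (A * s + B) • deriv c s)) s := by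
      have h1 := hcd.add (hη.smul (hcd.sub_const p))
      refine HasDerivAt.congr_of_eventuallyEq ?_ (f := fun s => c s + (ε * (A * s + B)) • (c s - p))
        (by filter_upwards [Icc_mem_nhds hsI.1 hsI.2] with y hy using hδe y hy)
      convert! h1 using 1
      rw [smul_add, smul_smul, smul_smul]
      abel
    have hΨ' : HasDerivAt Ψ (1 + ε * (A * inner ℝ (c s - p) (deriv c s) + (A * s + B))
        + ε ^ 2 * N ^ 2) s := by
      have h1 := ((hcd.sub_const p).norm_sq.const_mul (ε * A / 2)).add
        ((((hasDerivAt_id s).pow 2).const_mul (ε * A / 2)).add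
          ((hasDerivAt_id s).const_mul (1 + ε * B + ε ^ 2 * N ^ 2)))
      convert! h1 using 1
      simp
      ring
    rw [hδ'.deriv, hΨ'.deriv]
    refine (norm_add_smul_le hs (N := N) ?_).trans (le_of_eq ?_)
    · refine ((norm_add_le _ _).trans (le_of_eq ?_)).trans (hN s hsI)
      rw [norm_smul, norm_smul, hs, mul_one, Real.norm_eq_abs, Real.norm_eq_abs]
    · rw [inner_add_right, real_inner_smul_right, real_inner_smul_right, real_inner_self_eq_norm_sq,
        hs, real_inner_comm]
      ring
  rw [hac.integral_deriv_eq_sub] at key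
  refine key.trans (le_of_eq ?_)
  rw [hΨ]
  ring

/-- First variation: moving the curve radially away from a point of the unit ball does not
decrease its length. -/
theorem variation_nonneg (hc : IsMinLoop L c) {p : E3} (hp : ‖p‖ < 1) {a x b : ℝ} (hax : a < x)
    (hxb : x < b) (hb : b ≤ a + L) :
    0 ≤ (b - x) * (‖c x - p‖ ^ 2 - ‖c a - p‖ ^ 2) - (x - a) * (‖c b - p‖ ^ 2 - ‖c x - p‖ ^ 2)
      + (b - x) * (x - a) * (b - a) := by
  obtain ⟨R, hR⟩ := isCompact_Icc.exists_bound_of_continuousOn (s := Icc a b)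
    (f := fun s => c s - p) (hc.lip.continuous.sub continuous_const).continuousOn
  have hR0 : 0 ≤ R := (norm_nonneg _).trans (hR a ⟨le_rfl, by linarith⟩)
  set η : ℝ → ℝ := fun s => min ((s - a) * (b - x)) ((b - s) * (x - a)) with hη
  have hη1 : ∀ s ∈ Icc a x, η s = (b - x) * s + -(a * (b - x)) := by
    intro s hs
    rw [hη]
    simp only
    rw [min_eq_left (by nlinarith [hs.2])]
    ring
  have hη2 : ∀ s ∈ Icc x b, η s = -(x - a) * s + b * (x - a) := by
    intro s hs
    rw [hη]
    simp only
    rw [min_eq_right (by nlinarith [hs.1])]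
    ring
  have hη0 : ∀ s ∈ Icc a b, 0 ≤ η s := fun s hs =>
    le_min (mul_nonneg (by linarith [hs.1]) (by linarith))
      (mul_nonneg (by linarith [hs.2]) (by linarith))
  have hηle : ∀ s ∈ Icc a b, |η s| ≤ (b - a) * (b - a) := by
    intro s hs
    rw [abs_of_nonneg (hη0 s hs)]
    exact (min_le_left _ _).trans (by nlinarith [hs.1, hs.2])
  set N : ℝ := (b - a) * R + (b - a) * (b - a) with hNdef
  have key : ∀ ε : ℝ, 0 < ε → 0 ≤ ((b - x) * (‖c x - p‖ ^ 2 - ‖c a - p‖ ^ 2)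
      - (x - a) * (‖c b - p‖ ^ 2 - ‖c x - p‖ ^ 2) + (b - x) * (x - a) * (b - a)) / 2
      + ε * (N ^ 2 * (b - a)) := by
    intro ε hε
    set δ : ℝ → E3 := fun s => c s + (ε * η s) • (c s - p) with hδdef
    obtain ⟨K, hK⟩ : ∃ K : NNReal, LipschitzOnWith K δ (Icc a b) := by
      have hA : ContDiff ℝ 1 fun s : ℝ => (s - a) * (b - x) := by fun_prop
      have hB : ContDiff ℝ 1 fun s : ℝ => (b - s) * (x - a) := by fun_prop
      obtain ⟨K₁, hK₁⟩ := hA.contDiffOn.exists_lipschitzOnWith one_ne_zero (convex_Icc a b)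
        isCompact_Icc
      obtain ⟨K₂, hK₂⟩ := hB.contDiffOn.exists_lipschitzOnWith one_ne_zero (convex_Icc a b)
        isCompact_Icc
      have hη' : LipschitzOnWith (max K₁ K₂) η (Icc a b) := by
        rw [lipschitzOnWith_iff_restrict] at hK₁ hK₂ ⊢
        exact hK₁.min hK₂
      have hεη : LipschitzOnWith (‖ε‖₊ * max K₁ K₂) (fun s => ε * η s) (Icc a b) :=
        (lipschitzWith_smul ε).comp_lipschitzOnWith hη'
      have hcp : LipschitzOnWith 1 (fun s => c s - p) (Icc a b) := by
        intro s hs s' hs'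
        rw [edist_sub_right]
        exact hc.lip s s'
      obtain ⟨K₃, hK₃⟩ := exists_lipschitzOnWith_smul (by linarith) hεη hcp
      exact ⟨_, hc.lip.lipschitzOnWith.add hK₃⟩
    have hax' : Icc a x ⊆ Icc a b := Icc_subset_Icc_right hxb.le
    have hxb' : Icc x b ⊆ Icc a b := Icc_subset_Icc_left hax.le
    have h1 := hc.competitor one_pos (by linarith) hb hK
      (by simp [hδdef, hη1 a ⟨le_rfl, hax.le⟩, mul_comm])
      (by
        have : η b = 0 := by rw [hη2 b ⟨hxb.le, le_rfl⟩]; ring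
        simp [hδdef, this])
      (fun n hn => by
        rcases hc.supp_cases a b n hn with h1 | ⟨s, hs, h1⟩
        · exact Or.inl h1
        · refine Or.inr ⟨s, hs, ?_⟩
          have hnp : inner ℝ n p < 1 := by
            refine lt_of_le_of_lt (real_inner_le_norm n p) ?_
            rwa [hn, one_mul]
          rw [hδdef]
          simp only
          rw [inner_add_right, real_inner_smul_right, inner_sub_right]
          have := mul_nonneg (mul_nonneg hε.le (hη0 s hs)) (sub_nonneg.2 (hnp.le.trans h1))
          linarith)
    have hi := hK.intervalIntegrable_norm_deriv (by linarith)
    rw [← intervalIntegral.integral_add_adjacent_intervals (b := x)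
      (hi.mono_set (by rw [uIcc_of_le hax.le, uIcc_of_le (by linarith)]; exact hax'))
      (hi.mono_set (by rw [uIcc_of_le hxb.le, uIcc_of_le (by linarith)]; exact hxb'))] at h1
    have h2 := hc.integral_variation_le (N := N) (ε := ε) (p := p) hax.le (hK.mono hax')
      (fun s hs => by rw [← hη1 s hs]) (fun s hs => by
        rw [← hη1 s (Ioo_subset_Icc_self hs)]
        have hs' := hax' (Ioo_subset_Icc_self hs)
        refine add_le_add (mul_le_mul ?_ (hR s hs') (norm_nonneg _) (by linarith)) (hηle s hs')
        rw [abs_of_nonneg (by linarith)]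
        linarith)
    have h3 := hc.integral_variation_le (N := N) (ε := ε) (p := p) hxb.le (hK.mono hxb')
      (fun s hs => by rw [← hη2 s hs]) (fun s hs => by
        rw [← hη2 s (Ioo_subset_Icc_self hs)]
        have hs' := hxb' (Ioo_subset_Icc_self hs)
        refine add_le_add (mul_le_mul ?_ (hR s hs') (norm_nonneg _) (by linarith)) (hηle s hs')
        rw [abs_neg, abs_of_nonneg (by linarith)]
        linarith)
    refine nonneg_of_mul_nonneg_right (b := _) ?_ hε
    linarith
  by_contra! hneg
  set Q := (b - x) * (‖c x - p‖ ^ 2 - ‖c a - p‖ ^ 2) - (x - a) * (‖c b - p‖ ^ 2 - ‖c x - p‖ ^ 2)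
      + (b - x) * (x - a) * (b - a)
  have hM : 0 ≤ N ^ 2 * (b - a) := mul_nonneg (sq_nonneg _) (by linarith)
  have h1 := key (-Q / (4 * (N ^ 2 * (b - a) + 1))) (by apply div_pos <;> linarith)
  have h2 : -Q / (4 * (N ^ 2 * (b - a) + 1)) * (N ^ 2 * (b - a)) ≤ -Q / 4 := by
    rw [div_mul_eq_mul_div, div_le_div_iff₀ (by linarith) (by norm_num)]
    nlinarith
  linarith

theorem concaveOn_norm_sub_sq (hc : IsMinLoop L c) {p : E3} (hp : ‖p‖ < 1) {a b : ℝ}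
    (hb : b ≤ a + L) : ConcaveOn ℝ (Icc a b) fun s => ‖c s - p‖ ^ 2 - s ^ 2 := by
  refine concaveOn_of_slope_anti_adjacent (convex_Icc _ _) fun {x y z} hx hz hxy hyz => ?_
  have h := hc.variation_nonneg hp hxy hyz (by linarith [hx.1, hz.2])
  rw [div_le_div_iff₀ (by linarith) (by linarith)]
  nlinarith

theorem exists_hasDerivWithinAt_norm_sub_sq (hc : IsMinLoop L c) {p : E3} (hp : ‖p‖ < 1) (t : ℝ) :
    ∃ D, HasDerivWithinAt (fun s => ‖c s - p‖ ^ 2) D (Ioi t) t := by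
  have h1 := (hc.concaveOn_norm_sub_sq hp (a := t - L / 2) (b := t + L / 2) (by linarith)).neg
  have h2 := h1.hasDerivWithinAt_rightDeriv_of_mem_interior (x := t)
    (by rw [interior_Icc]; constructor <;> linarith [hc.pos])
  have h3 := h2.neg.add ((hasDerivAt_id t).pow 2).hasDerivWithinAt
  refine ⟨_, h3.congr (fun s _ => by simp) (by simp)⟩

/-- A minimal loop has one-sided tangents. -/
theorem exists_hasDerivWithinAt (hc : IsMinLoop L c) (t : ℝ) :
    ∃ v, HasDerivWithinAt c v (Ioi t) t := by
  have key : ∀ i : Fin 3, ∃ D, HasDerivWithinAt (fun s => c s i) D (Ioi t) t := by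
    intro i
    set e : E3 := (1 / 2 : ℝ) • EuclideanSpace.single i 1 with he
    have hen : ‖e‖ = 1 / 2 := by rw [he, norm_smul]; simp
    obtain ⟨D₀, h₀⟩ := hc.exists_hasDerivWithinAt_norm_sub_sq (p := 0) (by simp) t
    obtain ⟨D₁, h₁⟩ := hc.exists_hasDerivWithinAt_norm_sub_sq (p := e) (by rw [hen]; norm_num) t
    refine ⟨_, ((h₀.sub h₁).add_const (1 / 4)).congr (fun s _ => ?_) ?_⟩
    all_goals
      show _ = ‖_‖ ^ 2 - ‖_‖ ^ 2 + _
      rw [sub_zero, norm_sub_sq_real, hen, he, real_inner_smul_right,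
        EuclideanSpace.inner_single_right]
      simp
      ring
  choose D hD using key
  refine ⟨WithLp.toLp 2 D, ?_⟩
  have h := hasDerivWithinAt_pi.2 hD
  exact (PiLp.continuousLinearEquiv 2 ℝ fun _ : Fin 3 => ℝ).symm.toContinuousLinearMap.hasFDerivAt.comp_hasDerivWithinAt t h

end IsMinLoop

theorem HasDerivWithinAt.exists_forall_norm_le {F : Type*} [NormedAddCommGroup F]
    [NormedSpace ℝ F] {c : ℝ → F} {v : F} {t : ℝ} (h : HasDerivWithinAt c v (Ioi t) t) {ε : ℝ}
    (hε : 0 < ε) : ∃ s₀ > 0, ∀ σ ∈ Icc 0 s₀, ‖c (t + σ) - c t - σ • v‖ ≤ ε * σ := by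
  have h1 := (Asymptotics.isLittleO_iff.1 (hasDerivWithinAt_iff_isLittleO.1 h)) hε
  obtain ⟨y, hy, h2⟩ := mem_nhdsGT_iff_exists_Ioc_subset.1 h1
  have hy' : t < y := hy
  refine ⟨y - t, by linarith, fun σ hσ => ?_⟩
  rcases eq_or_lt_of_le hσ.1 with e | e
  · simp [← e]
  · have h3 := h2 (show t + σ ∈ Ioc t y from ⟨by linarith, by linarith [hσ.2]⟩)
    simp only [mem_ofPred_eq, add_sub_cancel_left, Real.norm_eq_abs, abs_of_pos e] at h3
    exact h3

theorem exists_norm_eq_one_inner_eq_zero (u : E3) : ∃ n : E3, ‖n‖ = 1 ∧ inner ℝ n u = 0 := by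
  have h : (ℝ ∙ u)ᗮ ≠ ⊥ := by
    intro h
    have h1 := Submodule.finrank_add_finrank_orthogonal (ℝ ∙ u)
    have h2 := finrank_span_le_card (R := ℝ) ({u} : Set E3)
    rw [toFinset_singleton, Finset.card_singleton] at h2
    rw [h, finrank_bot, finrank_euclideanSpace_fin] at h1
    omega
  obtain ⟨m, hm, hm0⟩ := Submodule.exists_mem_ne_zero_of_ne_bot h
  refine ⟨‖m‖⁻¹ • m, norm_normalize hm0, ?_⟩
  rw [real_inner_smul_left, real_inner_comm, (Submodule.mem_orthogonal_singleton_iff_inner_right).1 hm,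
    mul_zero]

namespace IsMinLoop

variable {L : ℝ} {c : ℝ → E3}

theorem norm_le_one_of_hasDerivWithinAt (hc : IsMinLoop L c) {t : ℝ} {v : E3}
    (hv : HasDerivWithinAt c v (Ioi t) t) : ‖v‖ ≤ 1 := by
  refine le_of_forall_pos_le_add fun ε hε => ?_
  obtain ⟨s, hs, h⟩ := hv.exists_forall_norm_le hε
  have h1 := h s ⟨hs.le, le_rfl⟩
  have h2 := hc.norm_sub_le (t + s) t
  rw [add_sub_cancel_left, abs_of_pos hs] at h2
  have h3 := norm_sub_norm_le (s • v) (c (t + s) - c t)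
  rw [norm_sub_rev (s • v), norm_smul, Real.norm_eq_abs, abs_of_pos hs] at h3
  nlinarith

/-- Where `c` returns along a doubly traversed segment to a point of the hull boundary, it cannot
turn off that segment. -/
theorem not_isHullPoint_of_doubled (hc : IsMinLoop L c) {t ρ T : ℝ} {u : E3} (hu : ‖u‖ = 1)
    (hT : 0 < T) (hTL : 2 * T < L)
    (h : ∀ s ∈ Icc 0 T, c (t + s) = (ρ - s) • u ∧ c (t - s) = (ρ - s) • u) :
    ¬ IsHullPoint c (c (t + T)) := by
  rintro ⟨w, hw, hwmax⟩
  have hTm : T ∈ Icc 0 T := ⟨hT.le, le_rfl⟩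
  have hp := (h T hTm).1
  have h1 : 1 ≤ inner ℝ w (c (t + T)) := hc.one_le_inner hw hwmax
  have h2 := hwmax (t + 0)
  rw [(h 0 ⟨le_rfl, hT.le⟩).1, hp, real_inner_smul_right, real_inner_smul_right] at h2
  rw [hp, real_inner_smul_right] at h1
  have hwu : inner ℝ w u < 0 := by
    refine lt_of_le_of_ne ?_ fun e => ?_
    · nlinarith
    · rw [e, mul_zero] at h1
      linarith
  obtain ⟨v, hv⟩ := hc.exists_hasDerivWithinAt (t + T)
  have hv1 := hc.norm_le_one_of_hasDerivWithinAt hv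
  have hcut : 2 ≤ ‖v - u‖ := by
    refine le_of_forall_pos_le_add fun ε' hε' => ?_
    have hL := hc.pos
    obtain ⟨ε, hε, hεe⟩ : ∃ ε > 0, ε * (2 * L + 1) = ε' :=
      ⟨ε' / (2 * L + 1), by positivity, by field_simp⟩
    obtain ⟨s₀, hs₀, hsm⟩ := hv.exists_forall_norm_le hε
    obtain ⟨s, hs, hs1, hs2, hs3, hs4⟩ : ∃ s > 0, s ≤ s₀ ∧ s ≤ T ∧ s ≤ L - 2 * T ∧
        2 * ε * s < 1 := by
      refine ⟨min (min s₀ T) (min (L - 2 * T) (1 / (4 * ε))), ?_, ?_, ?_, ?_, ?_⟩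
      · exact lt_min (lt_min hs₀ hT) (lt_min (by linarith) (by positivity))
      · exact (min_le_left _ _).trans (min_le_left _ _)
      · exact (min_le_left _ _).trans (min_le_right _ _)
      · exact (min_le_right _ _).trans (min_le_left _ _)
      · have : min (min s₀ T) (min (L - 2 * T) (1 / (4 * ε))) ≤ 1 / (4 * ε) :=
          (min_le_right _ _).trans (min_le_right _ _)
        rw [le_div_iff₀ (by positivity)] at this
        linarith
    set a := t + T - s with ha
    set b := t + T + s with hb
    set z : E3 := (2 * s)⁻¹ • (c b - c a) with hz
    have hδ : LipschitzOnWith ‖z‖₊ (fun x => c a + (x - a) • z) (Icc a b) := by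
      refine LipschitzOnWith.of_dist_le_mul fun x _ y _ => ?_
      rw [dist_add_left, dist_eq_norm, ← sub_smul, norm_smul, dist_eq_norm, coe_nnnorm, mul_comm]
      simp
    have hba : b - a = 2 * s := by rw [ha, hb]; ring
    have hcomp := hc.competitor (κ := 1 - 2 * ε * s) (by linarith) (by linarith) (by linarith) hδ
      (by simp) (by
        simp only [hba, hz, smul_smul]
        rw [mul_inv_cancel₀ (by positivity), one_smul]
        abel)
      (fun n hn => by
        left
        have hret : ∀ σ ∈ Icc 0 s, c (t + T - σ) = c (t - T + σ + L) := by
          intro σ hσ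
          rw [hc.periodic, show t + T - σ = t + (T - σ) by ring,
            show t - T + σ = t - (T - σ) by ring,
            (h (T - σ) ⟨by linarith [hσ.2], by linarith [hσ.1]⟩).1,
            (h (T - σ) ⟨by linarith [hσ.2], by linarith [hσ.1]⟩).2]
        have h0 : 0 ≤ 2 * ε * s := by positivity
        rcases hc.supp_cases a b n hn with ⟨x, hx, h1⟩ | ⟨x, hx, h1⟩
        · exact ⟨x, hx, by linarith⟩
        · rcases le_total x (t + T) with hxt | hxt
          · refine ⟨t - T + (t + T - x) + L, ⟨by linarith, by linarith [hx.1]⟩, ?_⟩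
            rw [← hret (t + T - x) ⟨by linarith, by linarith [hx.1]⟩, _root_.sub_sub_cancel]
            linarith
          · set σ := x - (t + T) with hσ
            have hσm : σ ∈ Icc 0 s := ⟨by linarith, by linarith [hx.2]⟩
            have e1 := hsm σ ⟨hσm.1, hσm.2.trans hs1⟩
            have e2 := hsm s ⟨hs.le, hs1⟩
            rw [show t + T + σ = x by rw [hσ]; ring] at e1
            set p := c (t + T)
            have hl : σ / s ≤ 1 := (div_le_one hs).2 hσm.2
            have hl0 : 0 ≤ σ / s := div_nonneg hσm.1 hs.le
            have e3 : c x - (p + (σ / s) • (c b - p)) =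
                (c x - p - σ • v) - (σ / s) • (c b - p - s • v) := by
              rw [smul_sub (σ / s) (c b - p), smul_smul, div_mul_cancel₀ _ hs.ne']
              abel
            have e4 : ‖c x - (p + (σ / s) • (c b - p))‖ ≤ 2 * ε * s := by
              rw [e3]
              refine (_root_.norm_sub_le _ _).trans ?_
              rw [norm_smul, Real.norm_eq_abs, abs_of_nonneg hl0]
              have e5 : σ / s * ‖c b - p - s • v‖ ≤ 1 * (ε * s) :=
                mul_le_mul hl e2 (norm_nonneg _) zero_le_one
              have e6 : ε * σ ≤ ε * s := mul_le_mul_of_nonneg_left hσm.2 hε.le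
              linarith
            have e5 := real_inner_le_norm n (c x - (p + (σ / s) • (c b - p)))
            rw [hn, one_mul, inner_sub_right, inner_add_right, real_inner_smul_right, inner_sub_right] at e5
            rcases le_total (inner ℝ n (c b)) (inner ℝ n p) with hle | hle
            · refine ⟨t - T + 0 + L, ⟨by linarith, by linarith⟩, ?_⟩
              rw [← hret 0 ⟨le_rfl, hs.le⟩, sub_zero]
              nlinarith
            · refine ⟨b, ⟨le_rfl, by linarith⟩, ?_⟩
              nlinarith)
    have hint : ∫ x in a..b, ‖deriv (fun x => c a + (x - a) • z) x‖ = ‖c b - c a‖ := by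
      have hd : ∀ x, deriv (fun x => c a + (x - a) • z) x = z := by
        intro x
        have := (((hasDerivAt_id x).sub_const a).smul_const z).const_add (c a)
        simpa using! this.deriv
      simp only [hd]
      rw [intervalIntegral.integral_const, hba, hz, norm_smul, smul_eq_mul, ← mul_assoc, norm_inv,
        Real.norm_eq_abs, abs_of_pos (by positivity), mul_inv_cancel₀ (by positivity), one_mul]
    rw [hint, hba] at hcomp
    have e2 := hsm s ⟨hs.le, hs1⟩
    have hca : c a = c (t + T) + s • u := by
      rw [ha, add_sub_assoc, (h (T - s) ⟨by linarith, by linarith⟩).1, hp, ← add_smul]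
      ring_nf
    have e3 : c b - c a = (c b - c (t + T) - s • v) + s • (v - u) := by
      rw [hca, smul_sub]; abel
    have e4 : ‖c b - c a‖ ≤ ε * s + s * ‖v - u‖ := by
      rw [e3]
      refine (norm_add_le _ _).trans (add_le_add e2 ?_)
      rw [norm_smul, Real.norm_eq_abs, abs_of_pos hs]
    refine le_of_mul_le_mul_left ?_ hs
    rw [← hεe]
    nlinarith
  have hvu : v = -u := by
    have e1 := norm_sub_sq_real v u
    have e2 := norm_add_sq_real v u
    have e3 : ‖v + u‖ = 0 := by
      have := norm_nonneg v
      rw [hu] at e1 e2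
      nlinarith [norm_nonneg (v + u)]
    exact eq_neg_of_add_eq_zero_left (norm_eq_zero.1 e3)
  obtain ⟨s, hs, hsm⟩ := hv.exists_forall_norm_le (ε := -inner ℝ w u / 2) (by linarith)
  have e1 := hsm s ⟨hs.le, le_rfl⟩
  have e2 := abs_real_inner_le_norm w (c (t + T + s) - c (t + T) - s • v)
  rw [hw, one_mul] at e2
  replace e2 := e2.trans e1
  have e3 := hwmax (t + T + s)
  rw [inner_sub_right, inner_sub_right, real_inner_smul_right, hvu, inner_neg_right] at e2
  have e4 := (abs_le.1 e2).1
  nlinarith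

theorem not_spike (hc : IsMinLoop L c) {t ρ ε : ℝ} {u : E3} (hu : ‖u‖ = 1) (hε : 0 < ε)
    (h : ∀ s ∈ Icc 0 ε, c (t + s) = (ρ - s) • u ∧ c (t - s) = (ρ - s) • u) : False := by
  have hL := hc.pos
  set S : Set ℝ := {τ | ∀ s ∈ Icc 0 τ, c (t + s) = (ρ - s) • u ∧ c (t - s) = (ρ - s) • u} with hS
  have hcont := hc.lip.continuous
  have hP : IsClosed {s | c (t + s) = (ρ - s) • u ∧ c (t - s) = (ρ - s) • u} :=
    (isClosed_eq (by fun_prop) (by fun_prop)).inter (isClosed_eq (by fun_prop) (by fun_prop))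
  set ε₁ := min ε (L / 2) with hε₁
  have hε₁0 : 0 < ε₁ := lt_min hε (by linarith)
  have hcl : IsClosed (S ∩ Icc ε₁ (L / 2)) := by
    rw [← isSeqClosed_iff_isClosed]
    intro x y hx hy
    have hyI : y ∈ Icc ε₁ (L / 2) :=
      isClosed_Icc.mem_of_tendsto hy (Filter.Eventually.of_forall fun n => (hx n).2)
    refine ⟨fun s hs => ?_, hyI⟩
    have hlt : ∀ s ∈ Ico 0 y, c (t + s) = (ρ - s) • u ∧ c (t - s) = (ρ - s) • u := by
      intro s hs
      obtain ⟨n, hn⟩ := (hy.eventually_const_lt hs.2).exists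
      exact (hx n).1 s ⟨hs.1, hn.le⟩
    have := closure_minimal hlt hP
    rw [closure_Ico (by linarith [hyI.1])] at this
    exact this hs
  have hfull : Icc ε₁ (L / 2) ⊆ S := by
    refine hcl.Icc_subset_of_forall_mem_nhdsWithin
      (fun s hs => h s ⟨hs.1, hs.2.trans (min_le_left _ _)⟩) fun T hT => ?_
    have hT0 : 0 < T := by linarith [hT.2.1]
    have hTm : T ∈ Icc 0 T := ⟨hT0.le, le_rfl⟩
    have hnot := hc.not_isHullPoint_of_doubled hu hT0 (by linarith [hT.2.2]) hT.1
    have hnot' : ¬ IsHullPoint c (c (t - T)) := by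
      rwa [(hT.1 T hTm).2, ← (hT.1 T hTm).1]
    obtain ⟨e₁, he₁, v₁, -, hs₁⟩ := hc.exists_straight hnot
    obtain ⟨e₂, he₂, v₂, -, hs₂⟩ := hc.exists_straight hnot'
    set e := min (min e₁ e₂) T with he
    have he0 : 0 < e := lt_min (lt_min he₁ he₂) hT0
    have hee₁ : e ≤ e₁ := (min_le_left _ _).trans (min_le_left _ _)
    have hee₂ : e ≤ e₂ := (min_le_left _ _).trans (min_le_right _ _)
    have heT : e ≤ T := min_le_right _ _
    have hmem : T - e ∈ Icc 0 T := ⟨by linarith, by linarith⟩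
    have hv₁ : v₁ = -u := by
      have h1 := hs₁ (t + (T - e)) ⟨by linarith, by linarith⟩
      rw [(hT.1 _ hmem).1, (hT.1 T hTm).1, show t + (T - e) - (t + T) = -e by ring] at h1
      have h2 : e • (v₁ + u) = 0 := by
        rw [show ρ - (T - e) = (ρ - T) + e by ring, add_smul, neg_smul] at h1
        rw [smul_add]
        have := add_left_cancel h1
        rw [this]; abel
      exact eq_neg_of_add_eq_zero_left ((smul_eq_zero.1 h2).resolve_left he0.ne')
    have hv₂ : v₂ = u := by
      have h1 := hs₂ (t - (T - e)) ⟨by linarith, by linarith⟩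
      rw [(hT.1 _ hmem).2, (hT.1 T hTm).2, show t - (T - e) - (t - T) = e by ring] at h1
      rw [show ρ - (T - e) = (ρ - T) + e by ring, add_smul] at h1
      exact (smul_right_injective E3 he0.ne' (add_left_cancel h1)).symm
    refine mem_nhdsGT_iff_exists_Ioc_subset.2 ⟨T + e, by simpa using he0, fun τ hτ s hs => ?_⟩
    rcases le_total s T with hsT | hsT
    · exact hT.1 s ⟨hs.1, hsT⟩
    · constructor
      · rw [hs₁ (t + s) ⟨by linarith, by linarith [hs.2, hτ.2]⟩, (hT.1 T hTm).1, hv₁, smul_neg,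
          ← neg_smul, ← add_smul]
        ring_nf
      · rw [hs₂ (t - s) ⟨by linarith [hs.2, hτ.2], by linarith⟩, (hT.1 T hTm).2, hv₂, ← add_smul]
        ring_nf
  have hall := hfull (right_mem_Icc.2 (min_le_right _ _))
  obtain ⟨n, hn, hnu⟩ := exists_norm_eq_one_inner_eq_zero u
  obtain ⟨s, hs⟩ := hc.supp n hn
  obtain ⟨s', hs', e⟩ := hc.exists_mem_Icc_eq (t - L / 2) s
  rw [← e] at hs
  rcases le_total s' t with hst | hst
  · have := (hall (t - s') ⟨by linarith, by linarith [hs'.1]⟩).2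
    rw [_root_.sub_sub_cancel] at this
    rw [this, real_inner_smul_right, hnu, mul_zero] at hs
    linarith
  · have := (hall (s' - t) ⟨by linarith, by linarith [hs'.2]⟩).1
    rw [add_sub_cancel] at this
    rw [this, real_inner_smul_right, hnu, mul_zero] at hs
    linarith

end IsMinLoop

namespace IsPolarArc

variable {L : ℝ} {c : ℝ → E3} {α β : ℝ} {θ : ℝ → ℝ}

/-- The radius has no interior dips along a radial part of the arc. -/
theorem min_norm_le {p : E3} (h : IsPolarArc c p α β θ) (hc : IsMinLoop L c) (hp : ‖p‖ < 1)
    (hβ : β ≤ α + L) (hθ : θ α = θ β) {x : ℝ} (hx : x ∈ Icc α β) :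
    min ‖c α - p‖ ‖c β - p‖ ≤ ‖c x - p‖ := by
  have hα' : α ∈ Icc α β := ⟨le_rfl, h.le⟩
  have hβ' : β ∈ Icc α β := ⟨h.le, le_rfl⟩
  have hxθ : θ x = θ α :=
    le_antisymm ((h.monotoneOn hx hβ' hx.2).trans hθ.ge) (h.monotoneOn hα' hx hx.1)
  have h1 := h.le_of_le hc hp hβ (φ := θ α) (d := min ‖c α - p‖ ‖c β - p‖) hα' hβ' hx.1 hx.2
    (by linarith [pi_pos]) (by linarith [pi_pos])
    (lt_min (norm_pos_iff.2 (sub_ne_zero.2 (h.ne α hα')))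
      (norm_pos_iff.2 (sub_ne_zero.2 (h.ne β hβ'))))
    (by simp) (by simp [hθ])
  simpa [hxθ] using h1

/-- A radial part of the arc is not traversed back and forth. -/
theorem not_radial_loop (h : IsPolarArc c 0 α β θ) (hc : IsMinLoop L c) (hαβ : α < β)
    (hβ : β ≤ α + L) (hθ : θ α = θ β) (hr : ‖c α‖ = ‖c β‖) : False := by
  have hα' : α ∈ Icc α β := ⟨le_rfl, h.le⟩
  have hβ' : β ∈ Icc α β := ⟨h.le, le_rfl⟩
  have hcont : Continuous fun s => ‖c s‖ := hc.lip.continuous.norm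
  set u : E3 := ‖c α‖⁻¹ • c α with hu
  have hu1 : ‖u‖ = 1 := norm_normalize (h.ne α hα')
  have hcu : ∀ s ∈ Icc α β, c s = ‖c s‖ • u := by
    intro s hs
    have h1 := h.norm_sub_le_angle hc hα' hs hs.1
    have h2 := h.monotoneOn hs hβ' hs.2
    simp only [sub_zero] at h1
    have h3 : ‖c s‖⁻¹ • c s = u := by
      rw [← sub_eq_zero, ← norm_le_zero_iff]
      linarith
    rw [← h3, norm_smul_normalize (h.ne s hs)]
  have hmin : ∀ s ∈ Icc α β, ‖c α‖ ≤ ‖c s‖ := by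
    intro s hs
    have := h.min_norm_le hc (by simp) hβ hθ hs
    simpa [hr] using this
  obtain ⟨t, ht, hmax⟩ := isCompact_Icc.exists_isMaxOn (nonempty_Icc.2 h.le) hcont.continuousOn
  have hmax' : ∀ s ∈ Icc α β, ‖c s‖ ≤ ‖c t‖ := fun s hs => hmax hs
  have hmaxα := hmax' α hα'
  rcases eq_or_lt_of_le hmaxα with e | hlt
  · have h1 := hc.chord_of_hullPoint hαβ hβ fun s hs _ => ⟨β, ⟨le_rfl, hβ⟩, by
      have hs' := Ioo_subset_Icc_self hs
      rw [hcu s hs', hcu β hβ', ← hr,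
        le_antisymm ((hmax' s hs').trans e.ge) (hmin s hs')]⟩
    rw [hcu β hβ', ← hr, ← hcu α hα', sub_self, norm_zero] at h1
    linarith
  · have hαt : α < t := lt_of_le_of_ne ht.1 fun e => by rw [← e] at hlt; exact lt_irrefl _ hlt
    have htβ : t < β := lt_of_le_of_ne ht.2 fun e => by rw [e, ← hr] at hlt; exact lt_irrefl _ hlt
    have hdist : ∀ s ∈ Icc α β, ‖c t - c s‖ = ‖c t‖ - ‖c s‖ := by
      intro s hs
      conv_lhs => rw [hcu t ht, hcu s hs]
      rw [← sub_smul, norm_smul, hu1, mul_one, Real.norm_eq_abs,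
        abs_of_nonneg (sub_nonneg.2 (hmax' s hs))]
    have h1 : ‖c t‖ - ‖c α‖ = t - α := by
      rw [← hdist α hα']
      refine hc.chord_of_hullPoint hαt (by linarith) fun s hs _ => ?_
      have hs' : s ∈ Icc α β := ⟨hs.1.le, hs.2.le.trans htβ.le⟩
      obtain ⟨s', hs'm, e⟩ := intermediate_value_Icc' htβ.le hcont.continuousOn
        (show ‖c s‖ ∈ Icc ‖c β‖ ‖c t‖ from ⟨hr ▸ hmin s hs', hmax' s hs'⟩)
      refine ⟨s', ⟨hs'm.1, hs'm.2.trans hβ⟩, ?_⟩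
      replace e : ‖c s'‖ = ‖c s‖ := e
      rw [hcu s' ⟨ht.1.trans hs'm.1, hs'm.2⟩, e, ← hcu s hs']
    have h2 : ‖c t‖ - ‖c β‖ = β - t := by
      rw [← hdist β hβ', norm_sub_rev]
      refine hc.chord_of_hullPoint htβ (by linarith) fun s hs _ => ?_
      have hs' : s ∈ Icc α β := ⟨hαt.le.trans hs.1.le, hs.2.le⟩
      obtain ⟨s', hs'm, e⟩ := intermediate_value_Icc hαt.le hcont.continuousOn
        (show ‖c s‖ ∈ Icc ‖c α‖ ‖c t‖ from ⟨hmin s hs', hmax' s hs'⟩)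
      refine ⟨s' + L, ⟨by linarith [hs'm.1], by linarith [hs'm.2]⟩, ?_⟩
      replace e : ‖c s'‖ = ‖c s‖ := e
      rw [hc.periodic, hcu s' ⟨hs'm.1, hs'm.2.trans ht.2⟩, e, ← hcu s hs']
    have hval : ∀ x y, x ≤ y → ‖c x‖ - ‖c y‖ ≤ y - x ∧ ‖c y‖ - ‖c x‖ ≤ y - x := by
      intro x y hxy
      have h3 := (abs_norm_sub_norm_le (c x) (c y)).trans (hc.norm_sub_le x y)
      rw [abs_sub_comm x y, abs_of_nonneg (sub_nonneg.2 hxy), abs_le] at h3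
      exact ⟨h3.2, by linarith [h3.1]⟩
    refine hc.not_spike (t := t) (ρ := ‖c t‖) (ε := t - α) hu1 (by linarith) fun s hs => ⟨?_, ?_⟩
    · have hm : t + s ∈ Icc α β := ⟨by linarith [hs.1], by linarith [hs.2]⟩
      rw [hcu _ hm]
      congr 1
      have h3 := (hval t (t + s) (by linarith [hs.1])).1
      have h4 := (hval (t + s) β hm.2).1
      linarith
    · have hm : t - s ∈ Icc α β := ⟨by linarith [hs.2], by linarith [hs.1]⟩
      rw [hcu _ hm]
      congr 1
      have h3 := (hval (t - s) t (by linarith [hs.1])).2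
      have h4 := (hval α (t - s) hm.1).2
      linarith

theorem injOn_polarCurve (h : IsPolarArc c 0 α β θ) (hc : IsMinLoop L c)
    (hβ : β ≤ α + L) (hθ : θ β - θ α < π) : InjOn (polarCurve (fun s => ‖c s‖) θ) (Icc α β) := by
  have key : ∀ x ∈ Icc α β, ∀ y ∈ Icc α β, x < y →
      polarCurve (fun s => ‖c s‖) θ x ≠ polarCurve (fun s => ‖c s‖) θ y := by
    intro x hx y hy hxy e
    have hr : ‖c x‖ = ‖c y‖ := by
      have := congrArg norm e
      simpa only [polarCurve, norm_mul, norm_exp_I_mul, mul_one, Complex.norm_real, norm_norm]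
        using this
    have hx0 : (‖c x‖ : ℂ) ≠ 0 := by
      rw [Complex.ofReal_ne_zero]
      exact norm_ne_zero_iff.2 (h.ne x hx)
    simp only [polarCurve] at e
    rw [← hr] at e
    have he := mul_left_cancel₀ hx0 e
    obtain ⟨n, hn⟩ := Complex.exp_eq_exp_iff_exists_int.1 he
    have hn' : θ x = θ y + n * (2 * π) := by
      have := congrArg Complex.im hn
      simpa using this
    have h1 := h.monotoneOn hx hy hxy.le
    have h2 := h.monotoneOn ⟨le_rfl, h.le⟩ hx hx.1
    have h3 := h.monotoneOn hy ⟨h.le, le_rfl⟩ hy.2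
    have hn0 : n = 0 := by
      have hp := pi_pos
      have h4 : (n : ℝ) < 1 := by nlinarith
      have h5 : (-1 : ℝ) < n := by nlinarith
      have h6 : n < 1 := by exact_mod_cast h4
      have h7 : -1 < n := by exact_mod_cast h5
      omega
    rw [hn0, Int.cast_zero, zero_mul, add_zero] at hn'
    exact (h.mono hx.1 hxy.le hy.2).not_radial_loop hc hxy (by linarith [hx.1, hy.2]) hn' hr
  intro x hx y hy e
  rcases lt_trichotomy x y with hxy | hxy | hxy
  · exact absurd e (key x hx y hy hxy)
  · exact hxy
  · exact absurd e.symm (key y hy x hx hxy)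

end IsPolarArc

namespace IsMinLoop

variable {L : ℝ} {c : ℝ → E3} {t : ℝ}

theorem exists_straight_of_eq_zero (hc : IsMinLoop L c) (ht : c t = 0) :
    ∃ ε > 0, ∃ u : E3, ‖u‖ = 1 ∧ (∀ s ∈ Icc (t - ε) (t + ε), c s = (s - t) • u) ∧
      ∀ s ∈ Ioo (t - ε) (t + ε), s ≠ t → deriv (fun u => ‖c u‖⁻¹ • c u) s = 0 := by
  obtain ⟨ε, hε, u, hu, h⟩ := hc.exists_straight (t := t)
    (hc.not_isHullPoint_of_norm_lt (by rw [ht, norm_zero]; exact one_pos))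
  have h' : ∀ s ∈ Icc (t - ε) (t + ε), c s = (s - t) • u := fun s hs => by
    rw [h s hs, ht, zero_add]
  refine ⟨ε, hε, u, hu, h', fun s hs hst => ?_⟩
  have hnorm : ∀ x ∈ Icc (t - ε) (t + ε), ‖c x‖ = |x - t| := fun x hx => by
    rw [h' x hx, norm_smul, hu, mul_one, Real.norm_eq_abs]
  rcases lt_or_gt_of_ne hst with hlt | hlt
  · have e : (fun x => ‖c x‖⁻¹ • c x) =ᶠ[nhds s] fun _ => -u := by
      filter_upwards [Ioo_mem_nhds hs.1 hlt] with x hx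
      have hx' : x ∈ Icc (t - ε) (t + ε) := ⟨hx.1.le, by linarith [hx.2]⟩
      have hne : x - t ≠ 0 := (sub_neg.2 hx.2).ne
      rw [hnorm x hx', h' x hx', abs_of_neg (sub_neg.2 hx.2), smul_smul, inv_neg, neg_mul,
        inv_mul_cancel₀ hne, neg_one_smul]
    rw [e.deriv_eq, deriv_const]
  · have e : (fun x => ‖c x‖⁻¹ • c x) =ᶠ[nhds s] fun _ => u := by
      filter_upwards [Ioo_mem_nhds hlt hs.2] with x hx
      have hx' : x ∈ Icc (t - ε) (t + ε) := ⟨by linarith [hx.1], hx.2.le⟩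
      have hpos : 0 < x - t := sub_pos.2 hx.1
      rw [hnorm x hx', h' x hx', abs_of_pos hpos, smul_smul, inv_mul_cancel₀ hpos.ne', one_smul]
    rw [e.deriv_eq, deriv_const]

theorem exists_Icc_ne_zero (hc : IsMinLoop L c) (ht : c t ≠ 0) :
    ∃ ε > 0, ∀ s ∈ Icc (t - ε) (t + ε), c s ≠ 0 := by
  obtain ⟨ε, hε, h⟩ := Metric.eventually_nhds_iff_ball.1
    (hc.lip.continuous.continuousAt.eventually_ne ht)
  refine ⟨ε / 2, half_pos hε, fun s hs => h s ?_⟩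
  rw [Metric.mem_ball, Real.dist_eq, abs_lt]
  exact ⟨by linarith [hs.1], by linarith [hs.2]⟩

/-- The radial projection of a minimal loop has locally bounded speed away from isolated points. -/
theorem locallyIntegrable_norm_deriv_normalize (hc : IsMinLoop L c) :
    LocallyIntegrable (fun s => ‖deriv (fun u => ‖c u‖⁻¹ • c u) s‖) volume := by
  intro t
  obtain ⟨ε, hε, K, hK⟩ : ∃ ε > 0, ∃ K : ℝ, ∀ s ∈ Ioo (t - ε) (t + ε), s ≠ t →
      ‖deriv (fun u => ‖c u‖⁻¹ • c u) s‖ ≤ K := by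
    by_cases ht : c t = 0
    · obtain ⟨ε, hε, -, -, -, h⟩ := hc.exists_straight_of_eq_zero ht
      exact ⟨ε, hε, 0, fun s hs hst => by rw [h s hs hst, norm_zero]⟩
    · obtain ⟨ε, hε, h⟩ := hc.exists_Icc_ne_zero ht
      obtain ⟨K, hK⟩ := hc.exists_lipschitzOnWith_normalize (by linarith) h
      simp only [sub_zero] at hK
      exact ⟨ε, hε, K, fun s hs _ => hK.norm_deriv_le_Icc hs⟩
  refine ⟨Ioo (t - ε) (t + ε), Ioo_mem_nhds (by linarith) (by linarith), ?_⟩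
  refine Measure.integrableOn_of_bounded (M := K) (by simp)
    (measurable_deriv _).norm.aestronglyMeasurable ?_
  rw [ae_restrict_iff' measurableSet_Ioo]
  filter_upwards [ae_ne_right t] with s hst hs
  rw [norm_norm]
  exact hK s hs hst

end IsMinLoop

namespace IsMinInspectionCurve

variable {L : ℝ} {γ : AddCircle L → E3}

theorem intervalIntegrable_norm_projDeriv (hγ : IsMinInspectionCurve L γ) (a b : ℝ) :
    IntervalIntegrable (fun s => ‖projDeriv L γ s‖) volume a b :=
  (hγ.isMinLoop.locallyIntegrable_norm_deriv_normalize.integrableOn_isCompact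
    isCompact_uIcc).intervalIntegrable

theorem thetaFn_sub_thetaFn (hγ : IsMinInspectionCurve L γ) (x y : ℝ) :
    thetaFn L γ y - thetaFn L γ x = ∫ s in x..y, ‖projDeriv L γ s‖ :=
  intervalIntegral.integral_interval_sub_left (hγ.intervalIntegrable_norm_projDeriv 0 y)
    (hγ.intervalIntegrable_norm_projDeriv 0 x)

theorem continuous_thetaFn (hγ : IsMinInspectionCurve L γ) : Continuous (thetaFn L γ) :=
  intervalIntegral.continuous_primitive hγ.intervalIntegrable_norm_projDeriv 0

theorem isPolarArc (hγ : IsMinInspectionCurve L γ) {α β : ℝ} (hαβ : α ≤ β)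
    (hne : ∀ s ∈ Icc α β, liftCurve L γ s ≠ 0) :
    IsPolarArc (liftCurve L γ) 0 α β (thetaFn L γ) where
  le := hαβ
  ne := hne
  angle := fun x _ y _ _ => by
    simp only [sub_zero]
    exact hγ.thetaFn_sub_thetaFn x y

/-- Near a time at which the curve is not at the origin, it is a polar arc of small total angle. -/
theorem exists_isPolarArc (hγ : IsMinInspectionCurve L γ) {t : ℝ} (ht : liftCurve L γ t ≠ 0) :
    ∃ α β, α < t ∧ t < β ∧ β ≤ α + L ∧ thetaFn L γ β - thetaFn L γ α < π / 2 ∧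
      IsPolarArc (liftCurve L γ) 0 α β (thetaFn L γ) := by
  obtain ⟨ε, hε, hne⟩ := hγ.isMinLoop.exists_Icc_ne_zero ht
  obtain ⟨δ, hδ, hθ⟩ := Metric.continuous_iff.1 hγ.continuous_thetaFn t (π / 4) (by positivity)
  have hL := hγ.isMinLoop.pos
  set η := min ε (min (δ / 2) (L / 2)) with hη
  have hηpos : 0 < η := lt_min hε (lt_min (half_pos hδ) (half_pos hL))
  have h1 : η ≤ ε := min_le_left _ _
  have h2 : η ≤ δ / 2 := (min_le_right _ _).trans (min_le_left _ _)
  have h3 : η ≤ L / 2 := (min_le_right _ _).trans (min_le_right _ _)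
  have hβ := hθ (t + η) (by rw [Real.dist_eq, add_sub_cancel_left, abs_of_pos hηpos]; linarith)
  have hα := hθ (t - η) (by
    rw [Real.dist_eq, sub_sub_cancel_left, abs_neg, abs_of_pos hηpos]; linarith)
  rw [Real.dist_eq, abs_lt] at hα hβ
  exact ⟨t - η, t + η, by linarith, by linarith, by linarith, by linarith [hα.1, hβ.2],
    hγ.isPolarArc (by linarith) fun s hs => hne s ⟨by linarith [hs.1], by linarith [hs.2]⟩⟩

theorem exists_straight_of_eq_zero (hγ : IsMinInspectionCurve L γ) {t : ℝ}
    (ht : liftCurve L γ t = 0) :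
    ∀ᶠ s in nhds t, ‖liftCurve L γ s‖ = |s - t| ∧ thetaFn L γ s = thetaFn L γ t := by
  obtain ⟨ε, hε, u, hu, h, hd⟩ := hγ.isMinLoop.exists_straight_of_eq_zero ht
  filter_upwards [Ioo_mem_nhds (show t - ε < t by linarith) (show t < t + ε by linarith)] with s hs
  refine ⟨by rw [h s ⟨hs.1.le, hs.2.le⟩, norm_smul, hu, mul_one, Real.norm_eq_abs], ?_⟩
  rw [← sub_eq_zero, hγ.thetaFn_sub_thetaFn]
  refine intervalIntegral.integral_zero_ae ?_
  filter_upwards [ae_ne_right t] with x hx hxm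
  rw [norm_eq_zero]
  refine hd x ?_ hx
  have htm : t ∈ Ioo (t - ε) (t + ε) := ⟨by linarith, by linarith⟩
  exact ordConnected_Ioo.uIcc_subset htm hs (uIoc_subset_uIcc hxm)

end IsMinInspectionCurve

theorem eventually_mem_Icc_left {a b t : ℝ} (h : a < t ∨ a = 0) :
    ∀ᶠ s in nhdsWithin t (Icc 0 b), a ≤ s := by
  rcases h with h | h
  · exact Filter.Eventually.filter_mono nhdsWithin_le_nhds
      ((eventually_gt_nhds h).mono fun s hs => hs.le)
  · filter_upwards [self_mem_nhdsWithin] with s hs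
    exact h ▸ hs.1

theorem eventually_mem_Icc_right {a b t : ℝ} (h : t < a ∨ a = b) :
    ∀ᶠ s in nhdsWithin t (Icc 0 b), s ≤ a := by
  rcases h with h | h
  · exact Filter.Eventually.filter_mono nhdsWithin_le_nhds
      ((eventually_lt_nhds h).mono fun s hs => hs.le)
  · filter_upwards [self_mem_nhdsWithin] with s hs
    exact h ▸ hs.2

namespace IsUnfolding

variable {L : ℝ} {γ : AddCircle L → E3} {γt : ℝ → ℂ} {t : ℝ}

/-- Away from the origin, the unfolding is locally the polar curve, up to a rotation. -/
theorem eventually_eq_of_ne_zero (hunf : IsUnfolding L γ γt) (ht : t ∈ Icc 0 L)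
    (hne : liftCurve L γ t ≠ 0) :
    ∃ κ : ℝ, ∀ᶠ s in nhdsWithin t (Icc 0 L), γt s = (‖liftCurve L γ s‖ : ℂ) *
      Complex.exp (Complex.I * Complex.ofReal (thetaFn L γ s + κ)) := by
  obtain ⟨m, tk, hm, hmono, htk0, htkm, hzero, hpiece⟩ := hunf
  have hex : ∃ k, 1 ≤ k ∧ k ≤ m ∧ t ≤ tk k := ⟨m, hm, le_rfl, htkm ▸ ht.2⟩
  classical
  obtain ⟨hk1, hkm, htk⟩ := Nat.find_spec hex
  have hmin : ∀ j < Nat.find hex, ¬(1 ≤ j ∧ j ≤ m ∧ t ≤ tk j) := fun j hj => Nat.find_min hex hj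
  generalize Nat.find hex = k at hk1 hkm htk hmin
  have hl : tk (k - 1) < t ∨ tk (k - 1) = 0 := by
    rcases Nat.eq_zero_or_pos (k - 1) with h | h
    · exact Or.inr (h ▸ htk0)
    · left
      by_contra! hcon
      exact hmin (k - 1) (by omega) ⟨h, by omega, hcon⟩
  have hr : t < tk k ∨ tk k = L := by
    rcases eq_or_lt_of_le hkm with h | h
    · exact Or.inr (h ▸ htkm)
    · refine Or.inl (lt_of_le_of_ne htk fun e => hne ?_)
      have h1 : tk 0 < tk k := hmono (Nat.zero_le m) hkm (by omega)
      have h2 : tk k < tk m := hmono hkm (le_refl m) h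
      exact (hzero t ⟨by rw [e]; linarith, by rw [e]; linarith⟩).2 ⟨k, hk1, h, e⟩
  refine ⟨((k : ℝ) - 1) * π, ?_⟩
  filter_upwards [eventually_mem_Icc_left hl, eventually_mem_Icc_right hr] with s h1 h2
  exact hpiece k hk1 hkm s ⟨h1, h2⟩

/-- At the origin, the two pieces of the unfolding are rotated by `π` against each other. -/
theorem eventually_eq_of_eq_zero (hunf : IsUnfolding L γ γt) (ht : t ∈ Icc 0 L)
    (hz : liftCurve L γ t = 0) :
    ∃ κ : ℝ, ∀ᶠ s in nhdsWithin t (Icc 0 L),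
      (s ≤ t → γt s = (‖liftCurve L γ s‖ : ℂ) *
        Complex.exp (Complex.I * Complex.ofReal (thetaFn L γ s + κ))) ∧
      (t ≤ s → γt s = (‖liftCurve L γ s‖ : ℂ) *
        Complex.exp (Complex.I * Complex.ofReal (thetaFn L γ s + (κ + π)))) := by
  obtain ⟨m, tk, hm, hmono, htk0, htkm, hzero, hpiece⟩ := hunf
  have hlt : ∀ i j, i < j → j ≤ m → tk i < tk j := fun i j hij hj =>
    hmono (show i ≤ m by omega) hj hij
  rcases eq_or_lt_of_le ht.1 with rfl | h0
  · refine ⟨-π, ?_⟩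
    have h01 := hlt 0 1 one_pos hm
    have hγt : ∀ s ∈ Icc (0 : ℝ) (tk 1), γt s = (‖liftCurve L γ s‖ : ℂ) *
        Complex.exp (Complex.I * Complex.ofReal (thetaFn L γ s + (-π + π))) := fun s hs => by
      rw [hpiece 1 le_rfl hm s (by simpa [htk0] using hs)]
      norm_num
    filter_upwards [self_mem_nhdsWithin,
      eventually_mem_Icc_right (Or.inl (htk0 ▸ h01))] with s hs hs1
    refine ⟨fun h => ?_, fun h => hγt s ⟨hs.1, hs1⟩⟩
    obtain rfl : s = 0 := le_antisymm h hs.1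
    rw [hγt 0 ⟨le_rfl, hs1⟩, hz]
    simp
  rcases eq_or_lt_of_le ht.2 with rfl | hL
  · refine ⟨((m : ℝ) - 1) * π, ?_⟩
    have hl := hlt (m - 1) m (by omega) le_rfl
    filter_upwards [self_mem_nhdsWithin,
      eventually_mem_Icc_left (Or.inl (htkm ▸ hl))] with s hs hs1
    have hγt := hpiece m hm le_rfl s ⟨hs1, htkm ▸ hs.2⟩
    refine ⟨fun _ => hγt, fun h => ?_⟩
    obtain rfl : s = t := le_antisymm hs.2 h
    rw [hγt, hz]
    simp
  · obtain ⟨k, hk0, hkm, rfl⟩ := (hzero t ⟨h0, hL⟩).1 hz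
    refine ⟨((k : ℝ) - 1) * π, ?_⟩
    filter_upwards [eventually_mem_Icc_left (Or.inl (hlt (k - 1) k (by omega) hkm.le)),
      eventually_mem_Icc_right (Or.inl (hlt k (k + 1) (by omega) hkm))] with s hs1 hs2
    refine ⟨fun h => hpiece k hk0 hkm.le s ⟨hs1, h⟩, fun h => ?_⟩
    rw [hpiece (k + 1) (by omega) hkm s ⟨by simpa using h, hs2⟩]
    congr 4
    push_cast
    ring

/-- The unfolding passes straight through the origin. -/
theorem eventually_eq_smul (hunf : IsUnfolding L γ γt) (hγ : IsMinInspectionCurve L γ)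
    (ht : t ∈ Icc 0 L) (hz : liftCurve L γ t = 0) :
    ∃ z : ℂ, z ≠ 0 ∧ ∀ᶠ s in nhdsWithin t (Icc 0 L), γt s = ((t - s : ℝ) : ℂ) * z := by
  obtain ⟨κ, hκ⟩ := hunf.eventually_eq_of_eq_zero ht hz
  refine ⟨_, Complex.exp_ne_zero (Complex.I * Complex.ofReal (thetaFn L γ t + κ)), ?_⟩
  filter_upwards [hκ, nhdsWithin_le_nhds (hγ.exists_straight_of_eq_zero hz)] with s h1 ⟨h2, h3⟩
  rcases le_total s t with h | h
  · rw [h1.1 h, h2, h3, abs_of_nonpos (sub_nonpos.2 h), neg_sub]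
  · rw [h1.2 h, h2, h3, abs_of_nonneg (sub_nonneg.2 h), ← add_assoc,
      Complex.ofReal_add _ π, mul_add Complex.I, Complex.exp_add, mul_comm Complex.I (π : ℂ),
      Complex.exp_pi_mul_I]
    push_cast
    ring

end IsUnfolding

theorem dot2_exp_mul (a φ r θ : ℝ) :
    dot2 (Complex.exp (Complex.I * ((φ + a : ℝ) : ℂ)))
      ((r : ℂ) * Complex.exp (Complex.I * ((θ + a : ℝ) : ℂ))) = r * cos (θ - φ) := by
  have h : ∀ x : ℝ, Complex.exp (Complex.I * (x : ℂ)) = ⟨cos x, sin x⟩ := fun x => by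
    apply Complex.ext
    · rw [mul_comm, Complex.exp_ofReal_mul_I_re]
    · rw [mul_comm, Complex.exp_ofReal_mul_I_im]
  rw [h, h, ← add_sub_add_right_eq_sub θ φ a, cos_sub]
  simp only [dot2, Complex.re_ofReal_mul, Complex.im_ofReal_mul]
  ring

theorem IsUnfolding.exists_injOn {L : ℝ} {γ : AddCircle L → E3} {γt : ℝ → ℂ} {t : ℝ}
    (hunf : IsUnfolding L γ γt) (hγ : IsMinInspectionCurve L γ) (ht : t ∈ Icc 0 L) :
    ∃ U ∈ nhdsWithin t (Icc 0 L), InjOn γt U := by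
  by_cases hz : liftCurve L γ t = 0
  · obtain ⟨z, hz0, h⟩ := hunf.eventually_eq_smul hγ ht hz
    refine ⟨_, h, fun x hx y hy hxy => ?_⟩
    have hx' : γt x = ((t - x : ℝ) : ℂ) * z := hx
    have hy' : γt y = ((t - y : ℝ) : ℂ) * z := hy
    rw [hx', hy', mul_left_inj' hz0, Complex.ofReal_inj] at hxy
    linarith
  · obtain ⟨α, β, hαt, htβ, hβ, hθ, hP⟩ := hγ.exists_isPolarArc hz
    obtain ⟨κ, h⟩ := hunf.eventually_eq_of_ne_zero ht hz
    refine ⟨_, Filter.inter_mem h (nhdsWithin_le_nhds (Icc_mem_nhds hαt htβ)),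
      fun x hx y hy hxy => ?_⟩
    refine hP.injOn_polarCurve hγ.isMinLoop hβ (by linarith [pi_pos]) hx.2 hy.2 ?_
    have key : ∀ s, (‖liftCurve L γ s‖ : ℂ) *
        Complex.exp (Complex.I * Complex.ofReal (thetaFn L γ s + κ)) =
        polarCurve (fun s => ‖liftCurve L γ s‖) (thetaFn L γ) s *
          Complex.exp (Complex.I * (κ : ℂ)) := fun s => by
      rw [polarCurve, Complex.ofReal_add, mul_add, Complex.exp_add, mul_assoc]
    rw [show γt x = _ from hx.1, show γt y = _ from hy.1, key, key] at hxy
    exact mul_right_cancel₀ (Complex.exp_ne_zero _) hxy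

theorem IsUnfolding.hasLocalSupportLineAbove {L : ℝ} {γ : AddCircle L → E3} {γt : ℝ → ℂ} {t : ℝ}
    (hunf : IsUnfolding L γ γt) (hγ : IsMinInspectionCurve L γ) (ht : t ∈ Icc 0 L) :
    HasLocalSupportLineAbove γt (Icc 0 L) t := by
  by_cases hz : liftCurve L γ t = 0
  · obtain ⟨z, hz0, h⟩ := hunf.eventually_eq_smul hγ ht hz
    have hdot : ∀ r : ℝ, dot2 (Complex.I * z) ((r : ℂ) * z) = 0 := fun r => by
      simp only [dot2, Complex.re_ofReal_mul, Complex.im_ofReal_mul, Complex.I_mul_re,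
        Complex.I_mul_im]
      ring
    have hself := h.self_of_nhdsWithin ht
    refine ⟨Complex.I * z, mul_ne_zero Complex.I_ne_zero hz0, by rw [hself, hdot], _, h,
      fun s hs => ?_⟩
    rw [show γt s = _ from hs, hself, hdot, hdot]
  · obtain ⟨α, β, hαt, htβ, hβ, hθ, hP⟩ := hγ.exists_isPolarArc hz
    obtain ⟨κ, h⟩ := hunf.eventually_eq_of_ne_zero ht hz
    have hself := h.self_of_nhdsWithin ht
    obtain ⟨φ, hφ, hsupp⟩ := hP.exists_support hγ.isMinLoop (by simp) hβ hθ ⟨hαt.le, htβ.le⟩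
    simp only [sub_zero] at hsupp
    refine ⟨Complex.exp (Complex.I * ((φ + κ : ℝ) : ℂ)), Complex.exp_ne_zero _, ?_, _,
      Filter.inter_mem h (nhdsWithin_le_nhds (Icc_mem_nhds hαt htβ)), fun s hs => ?_⟩
    · rw [hself, dot2_exp_mul]
      positivity
    · rw [show γt s = _ from hs.1, hself, dot2_exp_mul, dot2_exp_mul]
      exact hsupp s hs.2

/-- The unfolding `γt` of a minimal inspection curve `γ` (parameterized
so that `0` is a local minimum point of `|γ|`) is locally convex with respect to the
origin on `[0, L]`: it is locally one-to-one, and through each of its points there passes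
a local support line such that the nearby part of `γt` lies on the side containing `o`. -/
theorem unfolding_locally_convex
    (L : ℝ) (γ : AddCircle L → E3) (hγ : IsMinInspectionCurve L γ)
    (h0 : IsLocalMin (fun s : ℝ => ‖liftCurve L γ s‖) 0)
    (γt : ℝ → ℂ) (hunf : IsUnfolding L γ γt) :
    LocConvexWrtOrigin γt (Set.Icc 0 L) := by
  exact ⟨fun _ ht => hunf.exists_injOn hγ ht, fun _ ht => hunf.hasLocalSupportLineAbove hγ ht⟩
end
end
end

section
/- There exists an absolute constant C > 0 (independent of n) such that for every n ≥ 1 the following holds: if x₁, …, x_N ∈ ℝⁿ with N ≤ 2n are points whose convex hull contains the unit sphere S^{n-1} centered at the origin o, then max_{1 ≤ i ≤ N} |x_i| ≥ √n / C. -/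
open Real Set MeasureTheory ENNReal

noncomputable section

/-- A linear functional `⟪w, ·⟫` takes at some generator of a convex hull a value no larger than
at a given point `v` of the hull. -/
lemma exists_inner_le_of_mem_convexHull {E ι : Type*} [NormedAddCommGroup E]
    [InnerProductSpace ℝ E] {x : ι → E} {v : E} (hv : v ∈ convexHull ℝ (Set.range x)) (w : E) :
    ∃ i, inner ℝ w (x i) ≤ inner ℝ w v := by
  by_contra! h
  have hconv : Convex ℝ {y : E | inner ℝ w v < inner ℝ w y} :=
    convex_halfSpace_gt (innerₗ E w).isLinear _
  have hmem := convexHull_min (by rintro _ ⟨i, rfl⟩; exact h i) hconv hv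
  exact lt_irrefl (inner ℝ w v) hmem

/-- Empirical approximation (Maurey): a point of the convex hull of points of norm at most `R` is
approximated by averages of `k` of these points, chosen with repetition. -/
lemma exists_sym_norm_sum_sub_sq_le {E ι : Type*} [NormedAddCommGroup E]
    [InnerProductSpace ℝ E] {x : ι → E} {R : ℝ} (hx : ∀ i, ‖x i‖ ≤ R) {v : E}
    (hv : v ∈ convexHull ℝ (Set.range x)) (k : ℕ) :
    ∃ s : Sym ι k, ‖((s : Multiset ι).map x).sum - (k : ℝ) • v‖ ^ 2 ≤ k * (2 * R) ^ 2 := by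
  induction k with
  | zero => exact ⟨Sym.nil, by simp⟩
  | succ k ih =>
    obtain ⟨s, hs⟩ := ih
    have hvR : ‖v‖ ≤ R := by
      have hmem := convexHull_min (t := Metric.closedBall (0 : E) R)
        (by rintro _ ⟨i, rfl⟩; simpa using hx i) (convex_closedBall 0 R) hv
      simpa using hmem
    obtain ⟨i, hi⟩ := exists_inner_le_of_mem_convexHull hv
      (((s : Multiset ι).map x).sum - (k : ℝ) • v)
    refine ⟨i ::ₛ s, ?_⟩
    have hsplit : (((i ::ₛ s : Sym ι (k + 1)) : Multiset ι).map x).sum - ((k + 1 : ℕ) : ℝ) • v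
        = (((s : Multiset ι).map x).sum - (k : ℝ) • v) + (x i - v) := by
      simp only [Sym.coe_cons, Multiset.map_cons, Multiset.sum_cons, Nat.cast_succ, add_smul,
        one_smul]
      abel
    have hdist : ‖x i - v‖ ^ 2 ≤ (2 * R) ^ 2 :=
      pow_le_pow_left₀ (norm_nonneg _) (by linarith [norm_sub_le (x i) v, hx i]) 2
    rw [hsplit, norm_add_sq_real, inner_sub_right]
    push_cast
    linarith

/-- Tikhomirov. There is an absolute constant `C > 0` such that for every
`n ≥ 1`, if at most `2n` points of `ℝⁿ` contain the unit sphere within their convex hull,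
then one of them has norm at least `√n / C`. -/
theorem points_containing_sphere_far :
    ∃ C : ℝ, 0 < C ∧
      ∀ (n : ℕ), 1 ≤ n →
        ∀ (N : ℕ), N ≤ 2 * n →
          ∀ x : Fin N → EuclideanSpace ℝ (Fin n),
            Metric.sphere (0 : EuclideanSpace ℝ (Fin n)) 1 ⊆ convexHull ℝ (Set.range x) →
            ∃ i, Real.sqrt n / C ≤ ‖x i‖ := by
  refine ⟨32, by norm_num, fun n hn N hN x hsub => ?_⟩
  by_contra! hlt
  have : Nonempty (Fin n) := ⟨⟨0, hn⟩⟩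
  have hn0 : (0 : ℝ) < n := by exact_mod_cast hn
  let c : Sym (Fin N) n → EuclideanSpace ℝ (Fin n) :=
    fun s => (n : ℝ)⁻¹ • ((s : Multiset (Fin N)).map x).sum
  have hball : Metric.closedBall (0 : EuclideanSpace ℝ (Fin n)) 1 ⊆ convexHull ℝ (Set.range x) := by
    rw [← convexHull_sphere_eq_closedBall 0 zero_le_one]
    exact convexHull_min hsub (convex_convexHull ℝ _)
  have hcover : Metric.closedBall (0 : EuclideanSpace ℝ (Fin n)) 1 ⊆
      ⋃ s, Metric.closedBall (c s) (1 / 16) := by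
    intro v hv
    obtain ⟨s, hs⟩ := exists_sym_norm_sum_sub_sq_le (fun i => (hlt i).le) (hball hv) n
    refine mem_iUnion.2 ⟨s, ?_⟩
    have hbound : ‖((s : Multiset (Fin N)).map x).sum - (n : ℝ) • v‖ ≤ n / 16 := by
      refine le_of_sq_le_sq ?_ (by positivity)
      refine hs.trans_eq ?_
      rw [mul_pow, div_pow, Real.sq_sqrt hn0.le]
      ring
    have hc : v - c s =
        -((n : ℝ)⁻¹ • (((s : Multiset (Fin N)).map x).sum - (n : ℝ) • v)) := by
      simp only [c, smul_sub, inv_smul_smul₀ hn0.ne', neg_sub]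
    rw [mem_closedBall_iff_norm, hc, norm_neg, norm_smul, norm_inv, Real.norm_natCast]
    calc (n : ℝ)⁻¹ * ‖((s : Multiset (Fin N)).map x).sum - (n : ℝ) • v‖
        ≤ (n : ℝ)⁻¹ * (n / 16) := by gcongr
      _ = 1 / 16 := by field_simp
  have hcard : Fintype.card (Sym (Fin N) n) ≤ 8 ^ n := by
    rw [Sym.card_sym_eq_choose, Fintype.card_fin]
    calc (N + n - 1).choose n ≤ 2 ^ (N + n - 1) := Nat.choose_le_two_pow _ _
      _ ≤ 2 ^ (3 * n) := Nat.pow_le_pow_right (by norm_num) (by omega)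
      _ = 8 ^ n := by rw [pow_mul]; norm_num
  have hvol : volume.real (Metric.closedBall (0 : EuclideanSpace ℝ (Fin n)) 1) ≤
      (1 / 2) ^ n * volume.real (Metric.closedBall (0 : EuclideanSpace ℝ (Fin n)) 1) := by
    calc volume.real (Metric.closedBall (0 : EuclideanSpace ℝ (Fin n)) 1)
        ≤ volume.real (⋃ s, Metric.closedBall (c s) (1 / 16)) :=
          measureReal_mono hcover
            (isCompact_iUnion fun s => isCompact_closedBall _ _).measure_lt_top.ne
      _ ≤ ∑ s, volume.real (Metric.closedBall (c s) (1 / 16)) := measureReal_iUnion_fintype_le _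
      _ = Fintype.card (Sym (Fin N) n) * ((1 / 16) ^ n *
            volume.real (Metric.closedBall (0 : EuclideanSpace ℝ (Fin n)) 1)) := by
          have hscale (s) : volume.real (Metric.closedBall (c s) (1 / 16)) = (1 / 16) ^ n *
              volume.real (Metric.closedBall (0 : EuclideanSpace ℝ (Fin n)) 1) := by
            rw [measureReal_def, Measure.addHaar_closedBall' _ _ (by norm_num),
              ENNReal.toReal_mul, ENNReal.toReal_ofReal (by positivity),
              finrank_euclideanSpace_fin, measureReal_def]
          simp only [hscale, Finset.sum_const, Finset.card_univ, nsmul_eq_mul]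
      _ ≤ 8 ^ n * ((1 / 16) ^ n *
            volume.real (Metric.closedBall (0 : EuclideanSpace ℝ (Fin n)) 1)) := by
          gcongr
          exact_mod_cast hcard
      _ = (1 / 2) ^ n * volume.real (Metric.closedBall (0 : EuclideanSpace ℝ (Fin n)) 1) := by
          rw [← mul_assoc, ← mul_pow]; norm_num
  have hpos : 0 < volume.real (Metric.closedBall (0 : EuclideanSpace ℝ (Fin n)) 1) :=
    ENNReal.toReal_pos (Metric.measure_closedBall_pos _ _ one_pos).ne'
      (isCompact_closedBall _ _).measure_lt_top.ne
  have hhalf : (1 / 2 : ℝ) ^ n < 1 := pow_lt_one₀ (by norm_num) (by norm_num) (by omega)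
  nlinarith
end
end
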